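/- arXiv:2107.03253 — 7 statements merged into one kernel-verified Lean document; each statement's English description precedes it below -/
import Mathlib

section
/- Fix Q ≥ 2, K ≥ 1 and T = 3. For every parameter θ = (β, γ, λ) with λ_1 < … < λ_{Q−1}, every initial outcome y_0 ∈ {1,…,Q}, every q_1, q_3 ∈ {1,…,Q−1} and q_2 ∈ {2,…,Q−1} (so Q ≥ 3 for this range to be nonempty), every x = (x_1, x_2, x_3) ∈ (ℝ^K)^3, and every α ∈ ℝ, the moment function m_{y_0,q_1,q_2,q_3}(y, x, θ) defined casewise by: exp(x_{13}′β + γ_{y_0,q_2} + λ_{q_3,q_1})·(exp(x_{32}′β + γ_{q_2,y_1} + λ_{q_2,q_3}) − 1)/(exp(λ_{q_2,q_2−1}) − 1) if y_1 ≤ q_1, y_2 = q_2, y_3 ≤ q_3; exp(x_{13}′β + γ_{y_0,q_2} + λ_{q_3,q_1})·(1 − exp(x_{23}′β + γ_{y_1,q_2} + λ_{q_3,q_2}))/(1 − exp(λ_{q_2−1,q_2})) if y_1 ≤ q_1, y_2 = q_2, y_3 > q_3; exp(x_{13}′β + γ_{y_0,q_2} + λ_{q_3,q_1}) if y_1 ≤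 q_1, y_2 > q_2; −1 if y_1 > q_1, y_2 < q_2; −(1 − exp(x_{32}′β + γ_{q_2,y_1} + λ_{q_2−1,q_3}))/(1 − exp(λ_{q_2−1,q_2})) if y_1 > q_1, y_2 = q_2, y_3 ≤ q_3; −(exp(x_{23}′β + γ_{y_1,q_2} + λ_{q_3,q_2−1}) − 1)/(exp(λ_{q_2,q_2−1}) − 1) if y_1 > q_1, y_2 = q_2, y_3 > q_3; and 0 otherwise, satisfies Σ_{y ∈ {1,…,Q}^3} p_{y_0}(y, x, θ, α) · m_{y_0,q_1,q_2,q_3}(y, x, θ) = 0. -/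
open Finset

/-- The logistic CDF `Λ(u) = 1/(1+exp(-u))`. -/
noncomputable def Lam (u : ℝ) : ℝ := 1 / (1 + Real.exp (-u))

/-- Probability that an ordered logit outcome with index `ζ` and thresholds
`lam` (categories `1,…,Q`, with the conventions `λ_0 = -∞`, `λ_Q = +∞`) equals `q`. -/
noncomputable def catProb (Q : ℕ) (lam : ℕ → ℝ) (ζ : ℝ) (q : ℕ) : ℝ :=
  (if q = 1 then 1 else Lam (ζ - lam (q - 1))) - (if q = Q then 0 else Lam (ζ - lam q))

theorem Lam_eq (t : ℝ) : Lam t = Real.exp t / (1 + Real.exp t) := by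
  unfold Lam
  rw [Real.exp_neg]
  have := Real.exp_pos t
  field_simp
  ring

theorem alg1 (ta tb tc : ℝ) (h : tb < ta) :
    (Lam ta - Lam tb) * ((1 - Lam tc) * ((Real.exp (tc - tb) - 1) / (Real.exp (ta - tb) - 1)) +
      Lam tc * ((1 - Real.exp (tb - tc)) / (1 - Real.exp (tb - ta)))) + Lam tb = Lam tc := by
  simp only [Lam_eq, Real.exp_sub]
  have h' := Real.exp_lt_exp.2 h
  have ha := Real.exp_pos ta
  have hb := Real.exp_pos tb
  have hc := Real.exp_pos tc
  generalize Real.exp ta = a at *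
  generalize Real.exp tb = b at *
  generalize Real.exp tc = c at *
  have h1 : a - b ≠ 0 := by linarith
  have e1 : (c / b - 1) / (a / b - 1) = (c - b) / (a - b) := by
    have : a / b - 1 ≠ 0 := by
      intro h0; field_simp at h0; exact h1 (by linarith)
    field_simp
  have e2 : (1 - b / c) / (1 - b / a) = a * (c - b) / (c * (a - b)) := by
    have : 1 - b / a ≠ 0 := by
      intro h0; field_simp at h0; exact h1 (by linarith)
    field_simp
  rw [e1, e2]
  field_simp
  ring

theorem alg2 (ta tb tc : ℝ) (h : tb < ta) :
    (1 - Lam ta) + (Lam ta - Lam tb) *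
      ((1 - Lam tc) * ((1 - Real.exp (tc - ta)) / (1 - Real.exp (tb - ta))) +
      Lam tc * ((Real.exp (ta - tc) - 1) / (Real.exp (ta - tb) - 1))) = 1 - Lam tc := by
  simp only [Lam_eq, Real.exp_sub]
  have h' := Real.exp_lt_exp.2 h
  have ha := Real.exp_pos ta
  have hb := Real.exp_pos tb
  have hc := Real.exp_pos tc
  generalize Real.exp ta = a at *
  generalize Real.exp tb = b at *
  generalize Real.exp tc = c at *
  have h1 : a - b ≠ 0 := by linarith
  have e1 : (a / c - 1) / (a / b - 1) = b * (a - c) / (c * (a - b)) := by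
    have : a / b - 1 ≠ 0 := by
      intro h0; field_simp at h0; exact h1 (by linarith)
    field_simp
  have e2 : (1 - c / a) / (1 - b / a) = (a - c) / (a - b) := by
    have : 1 - b / a ≠ 0 := by
      intro h0; field_simp at h0; exact h1 (by linarith)
    field_simp
  rw [e1, e2]
  field_simp
  ring

theorem alg3 (td tc : ℝ) :
    (1 - Lam td) * (Real.exp (td - tc) * Lam tc) + Lam td * (-(1 - Lam tc)) = 0 := by
  simp only [Lam_eq, Real.exp_sub]
  have ha := Real.exp_pos td
  have hc := Real.exp_pos tc
  field_simp
  ring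

theorem sum_low (Q : ℕ) (lam : ℕ → ℝ) (ζ : ℝ) (m : ℕ) (h1 : 1 ≤ m) (hm : m < Q) :
    ∑ y ∈ Finset.Icc 1 m, catProb Q lam ζ y = 1 - Lam (ζ - lam m) := by
  induction m, h1 using Nat.le_induction with
  | base =>
    have h2 : 1 ≠ Q := by omega
    simp [catProb, h2]
  | succ n hn ih =>
    rw [Finset.sum_Icc_succ_top (by omega), ih (by omega)]
    have h2 : n + 1 ≠ Q := by omega
    have h3 : n ≠ 0 := by omega
    simp [catProb, h2, h3]

theorem sum_all (Q : ℕ) (lam : ℕ → ℝ) (ζ : ℝ) (hQ : 2 ≤ Q) :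
    ∑ y ∈ Finset.Icc 1 Q, catProb Q lam ζ y = 1 := by
  obtain ⟨n, rfl⟩ : ∃ n, Q = n + 1 := ⟨Q - 1, by omega⟩
  rw [Finset.sum_Icc_succ_top (by omega), sum_low _ _ _ n (by omega) (by omega)]
  have h3 : n ≠ 0 := by omega
  simp [catProb, h3]

theorem sum_ind (Q : ℕ) (lam : ℕ → ℝ) (ζ : ℝ) (m : ℕ) (h1 : 1 ≤ m) (hm : m < Q) :
    ∑ y ∈ Finset.Icc 1 Q, catProb Q lam ζ y * (if y ≤ m then 1 else 0)
      = 1 - Lam (ζ - lam m) := by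
  rw [← sum_low Q lam ζ m h1 hm]
  simp only [mul_ite, mul_one, mul_zero]
  rw [← Finset.sum_filter]
  congr 1
  ext y
  simp only [Finset.mem_filter, Finset.mem_Icc]
  omega

theorem sum_two (Q : ℕ) (lam : ℕ → ℝ) (ζ : ℝ) (m : ℕ) (h1 : 1 ≤ m) (hm : m < Q) (A B : ℝ) :
    ∑ y ∈ Finset.Icc 1 Q, catProb Q lam ζ y * (if y ≤ m then A else B)
      = (1 - Lam (ζ - lam m)) * A + Lam (ζ - lam m) * B := by
  have h : ∀ y, catProb Q lam ζ y * (if y ≤ m then A else B) =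
      catProb Q lam ζ y * B + catProb Q lam ζ y * (if y ≤ m then 1 else 0) * (A - B) := by
    intro y; split_ifs <;> ring
  simp only [h]
  rw [Finset.sum_add_distrib, ← Finset.sum_mul, ← Finset.sum_mul, sum_all Q lam ζ (by omega),
    sum_ind Q lam ζ m h1 hm]
  ring

theorem sum_three (Q : ℕ) (lam : ℕ → ℝ) (ζ : ℝ) (m : ℕ) (h1 : 2 ≤ m) (hm : m < Q)
    (A B C : ℝ) :
    ∑ y ∈ Finset.Icc 1 Q, catProb Q lam ζ y * (if y < m then A else if y = m then B else C)
      = (1 - Lam (ζ - lam (m - 1))) * A + (Lam (ζ - lam (m - 1)) - Lam (ζ - lam m)) * B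
        + Lam (ζ - lam m) * C := by
  have h : ∀ y, catProb Q lam ζ y * (if y < m then A else if y = m then B else C) =
      catProb Q lam ζ y * (if y ≤ m - 1 then A - B else 0)
        + catProb Q lam ζ y * (if y ≤ m then B else C) := by
    intro y
    rcases lt_trichotomy y m with h | h | h
    · simp only [h, if_true, (by omega : y ≤ m - 1), h.le]; ring
    · subst h
      have h2 : ¬ y ≤ y - 1 := by omega
      simp [h2]
    · have h2 : ¬ y < m := by omega
      have h3 : ¬ y ≤ m - 1 := by omega
      have h4 : ¬ y ≤ m := by omega
      have h5 : ¬ y = m := by omega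
      simp [h2, h3, h4, h5]
  simp only [h]
  rw [Finset.sum_add_distrib, sum_two Q lam ζ m (by omega) hm,
    sum_two Q lam ζ (m - 1) (by omega) (by omega)]
  ring

theorem statement0 (Q K : ℕ) (hQ : 2 ≤ Q) (hK : 1 ≤ K)
    (β : Fin K → ℝ) (γ lam : ℕ → ℝ)
    (hlam : ∀ q r : ℕ, 1 ≤ q → q < r → r ≤ Q - 1 → lam q < lam r)
    (y0 q1 q2 q3 : ℕ)
    (hy0 : y0 ∈ Finset.Icc 1 Q)
    (hq1 : q1 ∈ Finset.Icc 1 (Q - 1))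
    (hq2 : q2 ∈ Finset.Icc 2 (Q - 1))
    (hq3 : q3 ∈ Finset.Icc 1 (Q - 1))
    (x1 x2 x3 : Fin K → ℝ) (α : ℝ) :
    (∑ y1 ∈ Finset.Icc 1 Q, ∑ y2 ∈ Finset.Icc 1 Q, ∑ y3 ∈ Finset.Icc 1 Q,
      (catProb Q lam ((∑ k, x1 k * β k) + γ y0 + α) y1 *
        catProb Q lam ((∑ k, x2 k * β k) + γ y1 + α) y2 *
        catProb Q lam ((∑ k, x3 k * β k) + γ y2 + α) y3) *
      (if y1 ≤ q1 ∧ y2 = q2 ∧ y3 ≤ q3 then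
          Real.exp ((∑ k, (x1 k - x3 k) * β k) + (γ y0 - γ q2) + (lam q3 - lam q1)) *
            ((Real.exp ((∑ k, (x3 k - x2 k) * β k) + (γ q2 - γ y1) + (lam q2 - lam q3)) - 1) /
              (Real.exp (lam q2 - lam (q2 - 1)) - 1))
        else if y1 ≤ q1 ∧ y2 = q2 ∧ q3 < y3 then
          Real.exp ((∑ k, (x1 k - x3 k) * β k) + (γ y0 - γ q2) + (lam q3 - lam q1)) *
            ((1 - Real.exp ((∑ k, (x2 k - x3 k) * β k) + (γ y1 - γ q2) + (lam q3 - lam q2))) /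
              (1 - Real.exp (lam (q2 - 1) - lam q2)))
        else if y1 ≤ q1 ∧ q2 < y2 then
          Real.exp ((∑ k, (x1 k - x3 k) * β k) + (γ y0 - γ q2) + (lam q3 - lam q1))
        else if q1 < y1 ∧ y2 < q2 then -1
        else if q1 < y1 ∧ y2 = q2 ∧ y3 ≤ q3 then
          -((1 - Real.exp ((∑ k, (x3 k - x2 k) * β k) + (γ q2 - γ y1) + (lam (q2 - 1) - lam q3))) /
              (1 - Real.exp (lam (q2 - 1) - lam q2)))
        else if q1 < y1 ∧ y2 = q2 ∧ q3 < y3 then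
          -((Real.exp ((∑ k, (x2 k - x3 k) * β k) + (γ y1 - γ q2) + (lam q3 - lam (q2 - 1))) - 1) /
              (Real.exp (lam q2 - lam (q2 - 1)) - 1))
        else 0)) = 0 := by
  rw [Finset.mem_Icc] at hq1 hq2 hq3
  have hl : lam (q2 - 1) < lam q2 := hlam _ _ (by omega) (by omega) (by omega)
  simp only [sub_mul, Finset.sum_sub_distrib]
  generalize (∑ k, x1 k * β k) = X1
  generalize (∑ k, x2 k * β k) = X2
  generalize (∑ k, x3 k * β k) = X3
  have key : ∀ y1 ∈ Finset.Icc 1 Q, (∑ y2 ∈ Finset.Icc 1 Q, ∑ y3 ∈ Finset.Icc 1 Q,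
      (catProb Q lam (X1 + γ y0 + α) y1 *
        catProb Q lam (X2 + γ y1 + α) y2 *
        catProb Q lam (X3 + γ y2 + α) y3) *
      (if y1 ≤ q1 ∧ y2 = q2 ∧ y3 ≤ q3 then
          Real.exp ((X1 - X3) + (γ y0 - γ q2) + (lam q3 - lam q1)) *
            ((Real.exp ((X3 - X2) + (γ q2 - γ y1) + (lam q2 - lam q3)) - 1) /
              (Real.exp (lam q2 - lam (q2 - 1)) - 1))
        else if y1 ≤ q1 ∧ y2 = q2 ∧ q3 < y3 then
          Real.exp ((X1 - X3) + (γ y0 - γ q2) + (lam q3 - lam q1)) *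
            ((1 - Real.exp ((X2 - X3) + (γ y1 - γ q2) + (lam q3 - lam q2))) /
              (1 - Real.exp (lam (q2 - 1) - lam q2)))
        else if y1 ≤ q1 ∧ q2 < y2 then
          Real.exp ((X1 - X3) + (γ y0 - γ q2) + (lam q3 - lam q1))
        else if q1 < y1 ∧ y2 < q2 then -1
        else if q1 < y1 ∧ y2 = q2 ∧ y3 ≤ q3 then
          -((1 - Real.exp ((X3 - X2) + (γ q2 - γ y1) + (lam (q2 - 1) - lam q3))) /
              (1 - Real.exp (lam (q2 - 1) - lam q2)))
        else if q1 < y1 ∧ y2 = q2 ∧ q3 < y3 then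
          -((Real.exp ((X2 - X3) + (γ y1 - γ q2) + (lam q3 - lam (q2 - 1))) - 1) /
              (Real.exp (lam q2 - lam (q2 - 1)) - 1))
        else 0)) = catProb Q lam (X1 + γ y0 + α) y1 *
      (if y1 ≤ q1 then Real.exp ((X1 + γ y0 + α - lam q1) - (X3 + γ q2 + α - lam q3)) *
          Lam (X3 + γ q2 + α - lam q3)
        else -(1 - Lam (X3 + γ q2 + α - lam q3))) := by
    intro y1 _
    by_cases h : y1 ≤ q1
    · have h' : ¬ q1 < y1 := by omega
      simp only [h, h', true_and, false_and, if_true, if_false]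
      have e0 : X1 - X3 + (γ y0 - γ q2) + (lam q3 - lam q1)
          = (X1 + γ y0 + α - lam q1) - (X3 + γ q2 + α - lam q3) := by ring
      have e1 : X3 - X2 + (γ q2 - γ y1) + (lam q2 - lam q3)
          = (X3 + γ q2 + α - lam q3) - (X2 + γ y1 + α - lam q2) := by ring
      have e2 : X2 - X3 + (γ y1 - γ q2) + (lam q3 - lam q2)
          = (X2 + γ y1 + α - lam q2) - (X3 + γ q2 + α - lam q3) := by ring
      have e3 : lam q2 - lam (q2 - 1)
          = (X2 + γ y1 + α - lam (q2 - 1)) - (X2 + γ y1 + α - lam q2) := by ring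
      have e4 : lam (q2 - 1) - lam q2
          = (X2 + γ y1 + α - lam q2) - (X2 + γ y1 + α - lam (q2 - 1)) := by ring
      rw [e0, e1, e2, e3, e4]
      have A := alg1 (X2 + γ y1 + α - lam (q2 - 1)) (X2 + γ y1 + α - lam q2)
        (X3 + γ q2 + α - lam q3) (by linarith)
      rw [← A]
      generalize Real.exp ((X1 + γ y0 + α - lam q1) - (X3 + γ q2 + α - lam q3)) = e
      generalize (Real.exp (_) - 1) / (Real.exp (_) - 1) = R1
      generalize (1 - Real.exp (_)) / (1 - Real.exp (_)) = R2
      have S := sum_three Q lam (X2 + γ y1 + α) q2 hq2.1 (by omega) 0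
        ((1 - Lam (X3 + γ q2 + α - lam q3)) * R1 + Lam (X3 + γ q2 + α - lam q3) * R2) 1
      rw [mul_zero, zero_add, mul_one] at S
      rw [← S, Finset.mul_sum, Finset.mul_sum]
      refine Finset.sum_congr rfl fun y2 _ => ?_
      rcases lt_trichotomy y2 q2 with g | g | g
      · simp [g, g.ne, g.not_gt]
      · subst g
        rw [← sum_two Q lam (X3 + γ y2 + α) q3 hq3.1 (by omega) R1 R2]
        simp only [lt_irrefl, if_false, if_true, true_and]
        simp only [Finset.mul_sum]
        refine Finset.sum_congr rfl fun y3 _ => ?_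
        by_cases k : y3 ≤ q3
        · simp only [k, if_true]; ring
        · simp only [k, if_false, not_le.1 k, if_true]; ring
      · simp only [g, g.ne', g.not_gt, false_and, if_false, if_true]
        rw [← Finset.sum_mul, ← Finset.mul_sum, sum_all Q lam _ hQ]
        ring
    · have h' : q1 < y1 := by omega
      simp only [h, h', true_and, false_and, if_true, if_false]
      have e1 : X3 - X2 + (γ q2 - γ y1) + (lam (q2 - 1) - lam q3)
          = (X3 + γ q2 + α - lam q3) - (X2 + γ y1 + α - lam (q2 - 1)) := by ring
      have e2 : X2 - X3 + (γ y1 - γ q2) + (lam q3 - lam (q2 - 1))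
          = (X2 + γ y1 + α - lam (q2 - 1)) - (X3 + γ q2 + α - lam q3) := by ring
      have e3 : lam q2 - lam (q2 - 1)
          = (X2 + γ y1 + α - lam (q2 - 1)) - (X2 + γ y1 + α - lam q2) := by ring
      have e4 : lam (q2 - 1) - lam q2
          = (X2 + γ y1 + α - lam q2) - (X2 + γ y1 + α - lam (q2 - 1)) := by ring
      rw [e1, e2, e3, e4]
      have A := alg2 (X2 + γ y1 + α - lam (q2 - 1)) (X2 + γ y1 + α - lam q2)
        (X3 + γ q2 + α - lam q3) (by linarith)
      rw [← A]
      generalize (Real.exp (_) - 1) / (Real.exp (_) - 1) = R2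
      generalize (1 - Real.exp (_)) / (1 - Real.exp (_)) = R1
      have S := sum_three Q lam (X2 + γ y1 + α) q2 hq2.1 (by omega) 1
        ((1 - Lam (X3 + γ q2 + α - lam q3)) * R1 + Lam (X3 + γ q2 + α - lam q3) * R2) 0
      rw [mul_zero, add_zero, mul_one] at S
      rw [← S, ← Finset.sum_neg_distrib, Finset.mul_sum]
      refine Finset.sum_congr rfl fun y2 _ => ?_
      rcases lt_trichotomy y2 q2 with g | g | g
      · simp only [g, g.ne, if_true]
        rw [← Finset.sum_mul, ← Finset.mul_sum, sum_all Q lam _ hQ]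
        ring
      · subst g
        rw [← sum_two Q lam (X3 + γ y2 + α) q3 hq3.1 (by omega) R1 R2]
        simp only [lt_irrefl, if_false, if_true, true_and]
        simp only [Finset.mul_sum, ← Finset.sum_neg_distrib]
        refine Finset.sum_congr rfl fun y3 _ => ?_
        by_cases k : y3 ≤ q3
        · simp only [k, if_true]; ring
        · simp only [k, if_false, not_le.1 k, if_true]; ring
      · simp [g.ne', g.not_gt]
  rw [Finset.sum_congr rfl key, sum_two Q lam _ q1 hq1.1 (by omega)]
  exact alg3 _ _
end

section
/- Fix Q ≥ 2, K ≥ 1 and T = 3. For every parameter θ = (β, γ, λ) with λ_1 < … < λ_{Q−1}, every initial outcome y_0 ∈ {1,…,Q}, every q_1, q_3 ∈ {1,…,Q−1}, every x = (x_1, x_2, x_3) ∈ (ℝ^K)^3, and every α ∈ ℝ, the moment function m_{y_0,q_1,Q,q_3}(y, x, θ) defined casewise by: exp(x_{12}′β + γ_{y_0,y_1} + λ_{Q−1,q_1}) if y_1 ≤ q_1, y_2 = Q, y_3 ≤ q_3; exp(x_{13}′β + γ_{y_0,Q} + λ_{q_3,q_1}) if y_1 ≤ q_1, y_2 = Q,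 y_3 > q_3; −1 if y_1 > q_1, y_2 < Q; exp(x_{32}′β + γ_{Q,y_1} + λ_{Q−1,q_3}) − 1 if y_1 > q_1, y_2 = Q, y_3 ≤ q_3; and 0 otherwise, satisfies Σ_{y ∈ {1,…,Q}^3} p_{y_0}(y, x, θ, α) · m_{y_0,q_1,Q,q_3}(y, x, θ) = 0. -/
open Finset

noncomputable def cutG (Q : ℕ) (lam : ℕ → ℝ) (ζ : ℝ) (q : ℕ) : ℝ :=
  if q = 0 then 1 else if q = Q then 0 else Lam (ζ - lam q)

lemma catProb_succ (Q : ℕ) (lam : ℕ → ℝ) (ζ : ℝ) (n : ℕ) (hn : n + 1 ≤ Q) :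
    catProb Q lam ζ (n + 1) = cutG Q lam ζ n - cutG Q lam ζ (n + 1) := by
  have h : n ≠ Q := by omega
  simp [catProb, cutG, h]

lemma sum_partial (Q : ℕ) (lam : ℕ → ℝ) (ζ u v : ℝ) (m n : ℕ) (hn : n ≤ Q) :
    ∑ y ∈ Finset.Icc 1 n, catProb Q lam ζ y * (if y ≤ m then u else v) =
      if n ≤ m then u * (1 - cutG Q lam ζ n)
      else u * (1 - cutG Q lam ζ m) + v * (cutG Q lam ζ m - cutG Q lam ζ n) := by
  induction n with
  | zero => simp [cutG]
  | succ k ih =>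
    rw [Finset.sum_Icc_succ_top (by omega), ih (by omega), catProb_succ Q lam ζ k hn]
    rcases lt_trichotomy k m with h | h | h
    · rw [if_pos (by omega), if_pos (by omega), if_pos (by omega)]; ring
    · subst h
      rw [if_pos (by omega), if_neg (by omega), if_neg (by omega)]; ring
    · rw [if_neg (by omega), if_neg (by omega), if_neg (by omega)]; ring

lemma sum_cut (Q : ℕ) (lam : ℕ → ℝ) (ζ u v : ℝ) (m : ℕ) (hm : m ∈ Finset.Icc 1 (Q - 1)) :
    ∑ y ∈ Finset.Icc 1 Q, catProb Q lam ζ y * (if y ≤ m then u else v) =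
      u * (1 - Lam (ζ - lam m)) + v * Lam (ζ - lam m) := by
  rw [Finset.mem_Icc] at hm
  have h0 : m ≠ 0 := by omega
  have h1 : m ≠ Q := by omega
  have h2 : Q ≠ 0 := by omega
  rw [sum_partial Q lam ζ u v m Q le_rfl, if_neg (by omega)]
  simp [cutG, h0, h1, h2]

lemma one_sub_Lam (u : ℝ) : 1 - Lam u = Lam u * Real.exp (-u) := by
  have : (1 + Real.exp (-u)) ≠ 0 := by positivity
  unfold Lam; field_simp; ring

lemma Lam_exp (u : ℝ) : (1 - Lam u) * Real.exp u = Lam u := by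
  rw [one_sub_Lam, mul_assoc, ← Real.exp_add]; simp

theorem statement2 (Q K : ℕ) (hQ : 2 ≤ Q) (hK : 1 ≤ K)
    (β : Fin K → ℝ) (γ lam : ℕ → ℝ)
    (hlam : ∀ q r : ℕ, 1 ≤ q → q < r → r ≤ Q - 1 → lam q < lam r)
    (y0 q1 q3 : ℕ)
    (hy0 : y0 ∈ Finset.Icc 1 Q)
    (hq1 : q1 ∈ Finset.Icc 1 (Q - 1))
    (hq3 : q3 ∈ Finset.Icc 1 (Q - 1))
    (x1 x2 x3 : Fin K → ℝ) (α : ℝ) :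
    (∑ y1 ∈ Finset.Icc 1 Q, ∑ y2 ∈ Finset.Icc 1 Q, ∑ y3 ∈ Finset.Icc 1 Q,
      (catProb Q lam ((∑ k, x1 k * β k) + γ y0 + α) y1 *
        catProb Q lam ((∑ k, x2 k * β k) + γ y1 + α) y2 *
        catProb Q lam ((∑ k, x3 k * β k) + γ y2 + α) y3) *
      (if y1 ≤ q1 ∧ y2 = Q ∧ y3 ≤ q3 then
          Real.exp ((∑ k, (x1 k - x2 k) * β k) + (γ y0 - γ y1) + (lam (Q - 1) - lam q1))
        else if y1 ≤ q1 ∧ y2 = Q ∧ q3 < y3 then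
          Real.exp ((∑ k, (x1 k - x3 k) * β k) + (γ y0 - γ Q) + (lam q3 - lam q1))
        else if q1 < y1 ∧ y2 < Q then -1
        else if q1 < y1 ∧ y2 = Q ∧ y3 ≤ q3 then
          Real.exp ((∑ k, (x3 k - x2 k) * β k) + (γ Q - γ y1) + (lam (Q - 1) - lam q3)) - 1
        else 0)) = 0 := by
  have hQm : Q - 1 ∈ Finset.Icc 1 (Q - 1) := by rw [Finset.mem_Icc]; omega
  simp only [sub_mul, Finset.sum_sub_distrib]
  generalize (∑ k, x1 k * β k) = X1
  generalize (∑ k, x2 k * β k) = X2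
  generalize (∑ k, x3 k * β k) = X3
  obtain ⟨A, hA⟩ : ∃ A, A = X1 + γ y0 + α - lam q1 := ⟨_, rfl⟩
  obtain ⟨c, hc⟩ : ∃ c, c = X3 + γ Q + α - lam q3 := ⟨_, rfl⟩
  have key : ∀ y1 ∈ Finset.Icc 1 Q, (∑ y2 ∈ Finset.Icc 1 Q, ∑ y3 ∈ Finset.Icc 1 Q,
      (catProb Q lam (X1 + γ y0 + α) y1 * catProb Q lam (X2 + γ y1 + α) y2 *
        catProb Q lam (X3 + γ y2 + α) y3) *
      (if y1 ≤ q1 ∧ y2 = Q ∧ y3 ≤ q3 then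
          Real.exp ((X1 - X2) + (γ y0 - γ y1) + (lam (Q - 1) - lam q1))
        else if y1 ≤ q1 ∧ y2 = Q ∧ q3 < y3 then
          Real.exp ((X1 - X3) + (γ y0 - γ Q) + (lam q3 - lam q1))
        else if q1 < y1 ∧ y2 < Q then -1
        else if q1 < y1 ∧ y2 = Q ∧ y3 ≤ q3 then
          Real.exp ((X3 - X2) + (γ Q - γ y1) + (lam (Q - 1) - lam q3)) - 1
        else 0)) = catProb Q lam (X1 + γ y0 + α) y1 *
          (if y1 ≤ q1 then Real.exp A * (1 - Lam c) else -(1 - Lam c)) := by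
    intro y1 _
    obtain ⟨b, hb⟩ : ∃ b, b = X2 + γ y1 + α - lam (Q - 1) := ⟨_, rfl⟩
    have e1 : Real.exp ((X1 - X2) + (γ y0 - γ y1) + (lam (Q - 1) - lam q1))
        = Real.exp A * Real.exp (-b) := by
      rw [← Real.exp_add, hA, hb]; congr 1; ring
    have e2 : Real.exp ((X1 - X3) + (γ y0 - γ Q) + (lam q3 - lam q1))
        = Real.exp A * Real.exp (-c) := by
      rw [← Real.exp_add, hA, hc]; congr 1; ring
    have e3 : Real.exp ((X3 - X2) + (γ Q - γ y1) + (lam (Q - 1) - lam q3))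
        = Real.exp c * Real.exp (-b) := by
      rw [← Real.exp_add, hc, hb]; congr 1; ring
    rw [e1, e2, e3]
    have hB := one_sub_Lam b
    have hC := one_sub_Lam c
    have hC' := Lam_exp c
    by_cases h : y1 ≤ q1
    · have h' : ¬ q1 < y1 := by omega
      simp only [h, h', true_and, false_and, if_true, if_false]
      trans ∑ y2 ∈ Finset.Icc 1 Q, catProb Q lam (X1 + γ y0 + α) y1 *
          (catProb Q lam (X2 + γ y1 + α) y2 * (if y2 ≤ Q - 1 then 0 else
          Real.exp A * Real.exp (-b) * (1 - Lam c) + Real.exp A * Real.exp (-c) * Lam c))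
      · refine Finset.sum_congr rfl fun y2 hy2 => ?_
        rw [Finset.mem_Icc] at hy2
        by_cases h2 : y2 = Q
        · subst h2
          rw [if_neg (by omega), hc, ← sum_cut _ _ _ _ _ _ hq3, ← hc, Finset.mul_sum,
            Finset.mul_sum]
          refine Finset.sum_congr rfl fun y3 _ => ?_
          by_cases h3 : y3 ≤ q3
          · simp [h3]; ring
          · simp [h3, not_le.mp h3]; ring
        · have : y2 ≤ Q - 1 := by omega
          simp [h2, this]
      · rw [← Finset.mul_sum, sum_cut _ _ _ _ _ _ hQm, ← hb]
        congr 1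
        linear_combination (-Real.exp A * (1 - Lam c)) * hB - Real.exp A * Lam b * hC
    · have h' : q1 < y1 := by omega
      simp only [h, h', true_and, false_and, if_true, if_false]
      trans ∑ y2 ∈ Finset.Icc 1 Q, catProb Q lam (X1 + γ y0 + α) y1 *
          (catProb Q lam (X2 + γ y1 + α) y2 * (if y2 ≤ Q - 1 then -1 else
          (Real.exp c * Real.exp (-b) - 1) * (1 - Lam c) + 0 * Lam c))
      · refine Finset.sum_congr rfl fun y2 hy2 => ?_
        rw [Finset.mem_Icc] at hy2
        by_cases h2 : y2 = Q
        · subst h2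
          rw [if_neg (by omega), hc, ← sum_cut _ _ _ _ _ _ hq3, ← hc, Finset.mul_sum,
            Finset.mul_sum]
          refine Finset.sum_congr rfl fun y3 _ => ?_
          by_cases h3 : y3 ≤ q3
          · simp [h3]; ring
          · simp [h3]
        · have h4 : y2 ≤ Q - 1 := by omega
          have h5 : y2 < Q := by omega
          have := sum_cut Q lam (X3 + γ y2 + α) (-1) (-1) q3 hq3
          simp only [ite_self] at this
          simp only [h4, h5, if_true, mul_assoc, ← Finset.mul_sum]
          rw [this]; ring
      · rw [← Finset.mul_sum, sum_cut _ _ _ _ _ _ hQm, ← hb]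
        congr 1
        linear_combination (Lam b * Real.exp (-b)) * hC' - Lam c * hB
  rw [Finset.sum_congr rfl key, sum_cut _ _ _ _ _ _ hq1, ← hA]
  linear_combination (1 - Lam c) * Lam_exp A
end

section
/- Fix Q ≥ 2, K ≥ 1 and T ≥ 3. Let θ = (β, γ, λ) with λ_1 < … < λ_{Q−1}, let y_0 ∈ {1,…,Q}, x = (x_1,…,x_T) ∈ (ℝ^K)^T, and for a path y ∈ {1,…,Q}^T write z_u = z(y_{u−1}, x_u, θ) for u ∈ {1,…,T} (with y_0 the initial outcome). For q_1, q_3 ∈ {1,…,Q−1} and time indices t, s, r with 1 ≤ t < s < r ≤ T, define m^{(t,s,r)}_{y_0,q_1,1,q_3}(y, x, θ) casewise by: exp(z_s − z_r + λ_{q_3,1}) − 1 if y_t ≤ q_1, y_s = 1, y_r > q_3; −1 if y_t ≤ q_1, y_s > 1; exp(z_r − z_t + λ_{q_1,q_3}) if y_t > q_1, y_s = 1, y_r ≤ q_3; exp(z_s − z_t + λ_{q_1,1}) if y_t > q_1, y_s = 1, y_r > q_3; and 0 otherwise. Then for every weight function w : {1,…,Q}^{t−1} → ℝ and every α ∈ ℝ: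 Σ_{y ∈ {1,…,Q}^T} w(y_1,…,y_{t−1}) · m^{(t,s,r)}_{y_0,q_1,1,q_3}(y, x, θ) · p_{y_0}(y, x, θ, α) = 0. -/
open Finset

/-- The full outcome path `u ↦ y_u` on `{0,1,…,T}`, with initial outcome `y_0` and
post-initial outcomes `y = (y_1,…,y_T)`. -/
def fullPath (T y0 : ℕ) (y : Fin T → ℕ) : ℕ → ℕ :=
  fun u => if h : 1 ≤ u ∧ u ≤ T then y ⟨u - 1, by omega⟩ else y0

/-- The single index `z_u = x_u′β + γ_{y_{u-1}}` for a path `p`. -/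
noncomputable def zidx {K : ℕ} (β : Fin K → ℝ) (γ : ℕ → ℝ)
    (x : ℕ → Fin K → ℝ) (p : ℕ → ℕ) (u : ℕ) : ℝ :=
  (∑ k, x u k * β k) + γ (p (u - 1))

/-- Model probability `p_{y_0}(y, x, θ, α)` of a full outcome path `p : ℕ → ℕ`
(with `p 0` the initial outcome). -/
noncomputable def pathProb (Q T : ℕ) {K : ℕ} (β : Fin K → ℝ) (γ lam : ℕ → ℝ)
    (x : ℕ → Fin K → ℝ) (α : ℝ) (p : ℕ → ℕ) : ℝ :=
  ∏ u ∈ Finset.Icc 1 T, catProb Q lam (zidx β γ x p u + α) (p u)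

/-- Iterated expectation of `F` over the coordinates `u, …, u+n-1` of a path, with Markov kernel `c`. -/
noncomputable def ES (c : ℕ → ℕ → ℕ → ℝ) (Q : ℕ) : ℕ → ℕ → (ℕ → ℕ) → ((ℕ → ℕ) → ℝ) → ℝ
  | 0, _, p, F => F p
  | n + 1, u, p, F => ∑ q ∈ Finset.Icc 1 Q, c u (p (u - 1)) q * ES c Q n (u + 1) (Function.update p u q) F

lemma ES_add (c : ℕ → ℕ → ℕ → ℝ) (Q m n u : ℕ) (p : ℕ → ℕ) (F : (ℕ → ℕ) → ℝ) :
    ES c Q (m + n) u p F = ES c Q m u p (fun p' => ES c Q n (u + m) p' F) := by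
  induction m generalizing u p with
  | zero => simp [ES]
  | succ m ih =>
    rw [show m + 1 + n = (m + n) + 1 by omega]
    simp only [ES, ih]
    rw [show u + 1 + m = u + (m + 1) by omega]

lemma ES_congr (c : ℕ → ℕ → ℕ → ℝ) (Q n u : ℕ) (p : ℕ → ℕ) (F G : (ℕ → ℕ) → ℝ)
    (h : ∀ p' : ℕ → ℕ, (∀ i, (i < u ∨ u + n ≤ i) → p' i = p i) → F p' = G p') :
    ES c Q n u p F = ES c Q n u p G := by
  induction n generalizing u p with
  | zero => exact h p (fun _ _ => rfl)
  | succ n ih =>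
    simp only [ES]
    refine Finset.sum_congr rfl fun q _ => ?_
    rw [ih]
    intro p' hp'
    apply h
    intro i hi
    rw [hp' i (by omega), Function.update_of_ne (by omega)]

lemma ES_affine (c : ℕ → ℕ → ℕ → ℝ) (Q : ℕ) (hc : ∀ u v, ∑ q ∈ Finset.Icc 1 Q, c u v q = 1)
    (n u : ℕ) (p : ℕ → ℕ) (a b : ℝ) (F : (ℕ → ℕ) → ℝ) :
    ES c Q n u p (fun p' => a * F p' + b) = a * ES c Q n u p F + b := by
  induction n generalizing u p with
  | zero => rfl
  | succ n ih =>
    simp only [ES, ih]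
    have : b = ∑ q ∈ Finset.Icc 1 Q, c u (p (u - 1)) q * b := by
      rw [← Finset.sum_mul, hc, one_mul]
    conv_rhs => rw [this]
    rw [Finset.mul_sum, ← Finset.sum_add_distrib]
    refine Finset.sum_congr rfl fun q _ => ?_
    ring

lemma ES_const (c : ℕ → ℕ → ℕ → ℝ) (Q : ℕ) (hc : ∀ u v, ∑ q ∈ Finset.Icc 1 Q, c u v q = 1)
    (n u : ℕ) (p : ℕ → ℕ) (b : ℝ) :
    ES c Q n u p (fun _ => b) = b := by
  have := ES_affine c Q hc n u p 0 b (fun _ => 0)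
  simpa using this

lemma ES_indep (c : ℕ → ℕ → ℕ → ℝ) (Q n u : ℕ) (p p' : ℕ → ℕ) (h : ℕ → ℝ)
    (hp : p u = p' u) :
    ES c Q n (u + 1) p (fun p => h (p (u + n))) = ES c Q n (u + 1) p' (fun p => h (p (u + n))) := by
  induction n generalizing u p p' with
  | zero => simp [ES, hp]
  | succ n ih =>
    simp only [ES]
    refine Finset.sum_congr rfl fun q _ => ?_
    have := ih (u + 1) (Function.update p (u + 1) q) (Function.update p' (u + 1) q) (by simp)
    rw [show u + 1 + n = u + (n + 1) by omega] at this
    rw [this]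
    simp [hp]

lemma fullPath_snoc (n y0 : ℕ) (y : Fin n → ℕ) (q : ℕ) :
    fullPath (n + 1) y0 (Fin.snoc (α := fun _ => ℕ) y q) = Function.update (fullPath n y0 y) (n + 1) q := by
  funext u
  by_cases hu : u = n + 1
  · subst hu
    simp [fullPath, Fin.snoc]
  · rw [Function.update_of_ne hu]
    unfold fullPath
    by_cases h : 1 ≤ u ∧ u ≤ n
    · rw [dif_pos h, dif_pos (by omega)]
      have : u - 1 < n := by omega
      simp [Fin.snoc, this]
    · rw [dif_neg h, dif_neg (by omega)]

lemma sum_eq_ES (c : ℕ → ℕ → ℕ → ℝ) (Q n y0 : ℕ) (F : (ℕ → ℕ) → ℝ) :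
    ∑ y ∈ Fintype.piFinset (fun _ : Fin n => Finset.Icc 1 Q),
      F (fullPath n y0 y) * ∏ u ∈ Finset.Icc 1 n, c u (fullPath n y0 y (u - 1)) (fullPath n y0 y u)
      = ES c Q n 1 (fun _ => y0) F := by
  induction n generalizing F with
  | zero =>
    simp only [ES]
    have : fullPath 0 y0 (fun i : Fin 0 => i.elim0) = fun _ => y0 := by
      funext u; unfold fullPath; rw [dif_neg (by omega)]
    rw [← this]
    simp
    congr 1
  | succ n ih =>
    rw [ES_add, ← ih]
    simp only [ES, Finset.sum_mul]
    rw [← Finset.sum_product']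
    refine (Finset.sum_nbij' (fun a => Fin.snoc (α := fun _ => ℕ) a.1 a.2)
      (fun y => (Fin.init y, y (Fin.last n))) ?_ ?_ ?_ ?_ ?_).symm
    · rintro ⟨y, q⟩ h
      simp only [Finset.mem_product, Fintype.mem_piFinset] at h
      rw [Fintype.mem_piFinset]
      intro i
      refine Fin.lastCases ?_ (fun j => ?_) i
      · simpa using h.2
      · simpa using h.1 j
    · intro y h
      rw [Fintype.mem_piFinset] at h
      simp only [Finset.mem_product, Fintype.mem_piFinset]
      exact ⟨fun i => h _, h _⟩
    · rintro ⟨y, q⟩ _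
      simp
    · intro y _
      simp
    · rintro ⟨y, q⟩ _
      simp only [fullPath_snoc]
      rw [Finset.prod_Icc_succ_top (by omega)]
      have : ∏ u ∈ Finset.Icc 1 n, c u (Function.update (fullPath n y0 y) (n + 1) q (u - 1))
            (Function.update (fullPath n y0 y) (n + 1) q u)
          = ∏ u ∈ Finset.Icc 1 n, c u (fullPath n y0 y (u - 1)) (fullPath n y0 y u) := by
        refine Finset.prod_congr rfl fun u hu => ?_
        rw [Finset.mem_Icc] at hu
        rw [Function.update_of_ne (by omega), Function.update_of_ne (by omega)]
      rw [this]
      simp [add_comm 1 n]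
      ring

lemma catProb_partial (Q : ℕ) (lam : ℕ → ℝ) (ζ : ℝ) (n : ℕ) (h1 : 1 ≤ n) (h2 : n < Q) :
    ∑ q ∈ Finset.Icc 1 n, catProb Q lam ζ q = 1 - Lam (ζ - lam n) := by
  induction n, h1 using Nat.le_induction with
  | base =>
    have e : ¬ 1 = Q := by omega
    simp [catProb, e]
  | succ n hn ih =>
    rw [Finset.sum_Icc_succ_top (by omega), ih (by omega)]
    have e : ¬ n + 1 = Q := by omega
    have e' : ¬ n = 0 := by omega
    simp [catProb, e, e']

lemma catProb_total (Q : ℕ) (hQ : 2 ≤ Q) (lam : ℕ → ℝ) (ζ : ℝ) :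
    ∑ q ∈ Finset.Icc 1 Q, catProb Q lam ζ q = 1 := by
  obtain ⟨n, rfl⟩ : ∃ n, Q = n + 1 := ⟨Q - 1, by omega⟩
  rw [Finset.sum_Icc_succ_top (by omega), catProb_partial _ _ _ _ (by omega) (by omega)]
  have e : ¬ n = 0 := by omega
  simp [catProb, e]

lemma catProb_split (Q : ℕ) (hQ : 2 ≤ Q) (lam : ℕ → ℝ) (ζ : ℝ) (n : ℕ) (h1 : 1 ≤ n) (h2 : n < Q)
    (a b : ℝ) :
    ∑ q ∈ Finset.Icc 1 Q, catProb Q lam ζ q * (if q ≤ n then a else b)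
      = a * (1 / (1 + Real.exp (ζ - lam n)))
        + b * (Real.exp (ζ - lam n) / (1 + Real.exp (ζ - lam n))) := by
  have e : ∀ q, catProb Q lam ζ q * (if q ≤ n then a else b)
      = b * catProb Q lam ζ q + (a - b) * (if q ≤ n then catProb Q lam ζ q else 0) := by
    intro q; split_ifs <;> ring
  simp only [e]
  rw [Finset.sum_add_distrib, ← Finset.mul_sum, ← Finset.mul_sum, catProb_total Q hQ,
    ← Finset.sum_filter]
  have : Finset.filter (fun q => q ≤ n) (Finset.Icc 1 Q) = Finset.Icc 1 n := by
    ext q; simp only [Finset.mem_filter, Finset.mem_Icc]; omega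
  rw [this, catProb_partial Q lam ζ n h1 h2]
  have hp := Real.exp_pos (ζ - lam n)
  unfold Lam
  rw [Real.exp_neg]
  have h3 : 1 + Real.exp (ζ - lam n) ≠ 0 := by positivity
  field_simp
  ring

/-- The core computation: from period `t` on, the expected moment function vanishes. -/
lemma core (Q : ℕ) (hQ : 2 ≤ Q) (g : ℕ → ℕ → ℝ) (lam : ℕ → ℝ) (α : ℝ)
    (q1 q3 : ℕ) (h1 : 1 ≤ q1) (h1' : q1 < Q) (h3 : 1 ≤ q3) (h3' : q3 < Q)
    (t a b d s r : ℕ) (ht : 1 ≤ t) (hs : s = t + 1 + a) (hr : r = s + 1 + b) (p : ℕ → ℕ) :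
    ES (fun u v q => catProb Q lam (g u v + α) q) Q (1 + (a + (1 + (b + (1 + d))))) t p
      (fun p => if p t ≤ q1 ∧ p s = 1 ∧ q3 < p r then
          Real.exp (g s (p (s - 1)) - g r (p (r - 1)) + (lam q3 - lam 1)) - 1
        else if p t ≤ q1 ∧ 1 < p s then -1
        else if q1 < p t ∧ p s = 1 ∧ p r ≤ q3 then
          Real.exp (g r (p (r - 1)) - g t (p (t - 1)) + (lam q1 - lam q3))
        else if q1 < p t ∧ p s = 1 ∧ q3 < p r then
          Real.exp (g s (p (s - 1)) - g t (p (t - 1)) + (lam q1 - lam 1))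
        else 0) = 0 := by
  set c : ℕ → ℕ → ℕ → ℝ := fun u v q => catProb Q lam (g u v + α) q with hcdef
  have hc : ∀ u v, ∑ q ∈ Finset.Icc 1 Q, c u v q = 1 := fun u v => catProb_total Q hQ _ _
  set F : (ℕ → ℕ) → ℝ := fun p => if p t ≤ q1 ∧ p s = 1 ∧ q3 < p r then
          Real.exp (g s (p (s - 1)) - g r (p (r - 1)) + (lam q3 - lam 1)) - 1
        else if p t ≤ q1 ∧ 1 < p s then -1
        else if q1 < p t ∧ p s = 1 ∧ p r ≤ q3 then
          Real.exp (g r (p (r - 1)) - g t (p (t - 1)) + (lam q1 - lam q3))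
        else if q1 < p t ∧ p s = 1 ∧ q3 < p r then
          Real.exp (g s (p (s - 1)) - g t (p (t - 1)) + (lam q1 - lam 1))
        else 0 with hF
  set A : ℕ → ℝ := fun v => Real.exp (g t v + α - lam q1) with hA
  set B : ℕ → ℝ := fun v => Real.exp (g s v + α - lam 1) with hB
  set C : ℕ → ℝ := fun v => Real.exp (g r v + α - lam q3) with hC
  have Apos : ∀ v, 0 < A v := fun v => Real.exp_pos _
  have Bpos : ∀ v, 0 < B v := fun v => Real.exp_pos _
  have Cpos : ∀ v, 0 < C v := fun v => Real.exp_pos _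
  -- the last block
  have hVr : ∀ p : ℕ → ℕ, 1 ≤ p s → ES c Q (1 + d) r p F =
      if p t ≤ q1 then (if p s = 1 then (1 + B (p (s - 1))) * (1 / (1 + C (p (r - 1)))) + (-1) else -1)
      else (if p s = 1 then
        (-((1 + B (p (s - 1))) / A (p (t - 1)))) * (1 / (1 + C (p (r - 1))))
          + (1 + B (p (s - 1))) / A (p (t - 1)) else 0) := by
    intro p hps
    rw [ES_add]
    have hFc : ∀ q, ES c Q d (r + 1) (Function.update p r q) F = F (Function.update p r q) := by
      intro q
      rw [ES_congr c Q d (r + 1) _ F (fun _ => F (Function.update p r q)), ES_const c Q hc]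
      intro p' hp'
      simp only [hF]
      rw [hp' t (by omega), hp' s (by omega), hp' r (by omega), hp' (t - 1) (by omega),
        hp' (s - 1) (by omega), hp' (r - 1) (by omega)]
    simp only [ES, hFc]
    have hFu : ∀ q, F (Function.update p r q) = if q ≤ q3 then
        (if p t ≤ q1 then (if p s = 1 then 0 else -1)
          else (if p s = 1 then C (p (r - 1)) / A (p (t - 1)) else 0))
        else (if p t ≤ q1 then (if p s = 1 then B (p (s - 1)) / C (p (r - 1)) - 1 else -1)
          else (if p s = 1 then B (p (s - 1)) / A (p (t - 1)) else 0)) := by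
      intro q
      simp only [hF, hA, hB, hC, ← Real.exp_sub]
      simp only [Function.update_of_ne (show t ≠ r by omega),
        Function.update_of_ne (show s ≠ r by omega), Function.update_of_ne (show t - 1 ≠ r by omega),
        Function.update_of_ne (show s - 1 ≠ r by omega),
        Function.update_of_ne (show r - 1 ≠ r by omega), Function.update_self]
      have e1 : g s (p (s - 1)) - g r (p (r - 1)) + (lam q3 - lam 1)
        = g s (p (s - 1)) + α - lam 1 - (g r (p (r - 1)) + α - lam q3) := by ring
      have e2 : g r (p (r - 1)) - g t (p (t - 1)) + (lam q1 - lam q3)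
        = g r (p (r - 1)) + α - lam q3 - (g t (p (t - 1)) + α - lam q1) := by ring
      have e3 : g s (p (s - 1)) - g t (p (t - 1)) + (lam q1 - lam 1)
        = g s (p (s - 1)) + α - lam 1 - (g t (p (t - 1)) + α - lam q1) := by ring
      rw [e1, e2, e3]
      by_cases c1 : p t ≤ q1
      · by_cases c2 : p s = 1
        · by_cases c3 : q ≤ q3
          · simp [c1, c2, c3, not_lt.2 c1, not_lt.2 c3]
          · simp [c1, c2, c3, not_le.1 c3]
        · have : 1 < p s := by omega
          simp [c1, c2, this]
      · by_cases c2 : p s = 1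
        · by_cases c3 : q ≤ q3
          · simp [c1, c2, c3, not_le.1 c1]
          · simp [c1, c2, c3, not_le.1 c1, not_le.1 c3]
        · simp [c1, c2]
    simp only [hFu, add_zero, hcdef]
    rw [catProb_split Q hQ lam _ q3 h3 h3']
    change _ * (1 / (1 + C (p (r - 1)))) + _ * (C (p (r - 1)) / (1 + C (p (r - 1)))) = _
    have hA0 := Apos (p (t - 1))
    have hB0 := Bpos (p (s - 1))
    have hC0 := Cpos (p (r - 1))
    generalize A (p (t - 1)) = A0 at *
    generalize B (p (s - 1)) = B0 at *
    generalize C (p (r - 1)) = C0 at *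
    have hC1 : 1 + C0 ≠ 0 := by positivity
    split_ifs <;> field_simp <;> ring
  -- the middle block
  set D : ℝ := ES c Q b (s + 1) (fun _ => 1) (fun p => 1 / (1 + C (p (s + b)))) with hD
  have hVs : ∀ p : ℕ → ℕ, ES c Q (1 + (b + (1 + d))) s p F =
      if p t ≤ q1 then D - 1 else (1 - D) / A (p (t - 1)) := by
    intro p
    rw [ES_add]
    have key : ∀ q, 1 ≤ q → ES c Q (b + (1 + d)) (s + 1) (Function.update p s q) F =
        if q ≤ 1 then
          (if p t ≤ q1 then (1 + B (p (s - 1))) * D + (-1) else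
            (-((1 + B (p (s - 1))) / A (p (t - 1)))) * D + (1 + B (p (s - 1))) / A (p (t - 1)))
        else (if p t ≤ q1 then -1 else 0) := by
      intro q hq
      rw [ES_add, ← hr]
      have hind : q = 1 → D = ES c Q b (s + 1) (Function.update p s q)
          (fun p => 1 / (1 + C (p (s + b)))) := by
        intro h
        exact ES_indep c Q b s _ _ (fun v => 1 / (1 + C v)) (by simp [h])
      have hrs : r - 1 = s + b := by omega
      have hval : ∀ p' : ℕ → ℕ,
          (∀ i, (i < s + 1 ∨ s + 1 + b ≤ i) → p' i = Function.update p s q i) →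
          p' t = p t ∧ p' s = q ∧ p' (s - 1) = p (s - 1) ∧ p' (t - 1) = p (t - 1) := by
        intro p' hp'
        rw [hp' t (by omega), hp' s (by omega), hp' (s - 1) (by omega), hp' (t - 1) (by omega)]
        simp [Function.update_of_ne (show t ≠ s by omega),
          Function.update_of_ne (show s - 1 ≠ s by omega),
          Function.update_of_ne (show t - 1 ≠ s by omega)]
      by_cases hq1 : q = 1
      · rw [if_pos (by omega)]
        split_ifs with c1
        · rw [hind hq1, ← ES_affine c Q hc]
          apply ES_congr
          intro p' hp'
          obtain ⟨v1, v2, v3, v4⟩ := hval p' hp'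
          rw [hVr p' (by omega), v1, v2, v3, v4, if_pos c1, if_pos hq1, hrs]
        · rw [hind hq1, ← ES_affine c Q hc]
          apply ES_congr
          intro p' hp'
          obtain ⟨v1, v2, v3, v4⟩ := hval p' hp'
          rw [hVr p' (by omega), v1, v2, v3, v4, if_neg c1, if_pos hq1, hrs]
      · rw [if_neg (by omega)]
        rw [ES_congr c Q b (s + 1) _ _ (fun _ => if p t ≤ q1 then -1 else 0), ES_const c Q hc]
        intro p' hp'
        obtain ⟨v1, v2, v3, v4⟩ := hval p' hp'
        simp only [hVr p' (by omega), v1, v2, if_neg hq1]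
    simp only [ES]
    rw [Finset.sum_congr rfl (fun q hq => by rw [key q (Finset.mem_Icc.1 hq).1])]
    simp only [hcdef]
    rw [catProb_split Q hQ lam _ 1 le_rfl (by omega)]
    change _ * (1 / (1 + B (p (s - 1)))) + _ * (B (p (s - 1)) / (1 + B (p (s - 1)))) = _
    have hA0 := Apos (p (t - 1))
    have hB0 := Bpos (p (s - 1))
    clear_value D
    generalize A (p (t - 1)) = A0 at *
    generalize B (p (s - 1)) = B0 at *
    have hB1 : 1 + B0 ≠ 0 := by positivity
    split_ifs <;> field_simp <;> ring
  -- the first block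
  rw [ES_add]
  have key : ∀ q, ES c Q (a + (1 + (b + (1 + d)))) (t + 1) (Function.update p t q) F =
      if q ≤ q1 then D - 1 else (1 - D) / A (p (t - 1)) := by
    intro q
    rw [ES_add, ← hs]
    rw [ES_congr c Q a (t + 1) _ _ (fun _ => if q ≤ q1 then D - 1 else (1 - D) / A (p (t - 1))),
      ES_const c Q hc]
    intro p' hp'
    rw [hVs, hp' t (by omega), hp' (t - 1) (by omega), Function.update_self,
      Function.update_of_ne (by omega)]
  simp only [ES, key]
  simp only [hcdef]
  rw [catProb_split Q hQ lam _ q1 h1 h1']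
  change _ * (1 / (1 + A (p (t - 1)))) + _ * (A (p (t - 1)) / (1 + A (p (t - 1)))) = _
  have hA0 := Apos (p (t - 1))
  clear_value D
  generalize A (p (t - 1)) = A0 at *
  have hA1 : 1 + A0 ≠ 0 := by positivity
  field_simp
  ring

theorem statement4 (Q K T : ℕ) (hQ : 2 ≤ Q) (hK : 1 ≤ K) (hT : 3 ≤ T)
    (β : Fin K → ℝ) (γ lam : ℕ → ℝ)
    (hlam : ∀ q r : ℕ, 1 ≤ q → q < r → r ≤ Q - 1 → lam q < lam r)
    (y0 : ℕ) (hy0 : y0 ∈ Finset.Icc 1 Q)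
    (q1 q3 : ℕ) (hq1 : q1 ∈ Finset.Icc 1 (Q - 1)) (hq3 : q3 ∈ Finset.Icc 1 (Q - 1))
    (t s r : ℕ) (ht : 1 ≤ t) (hts : t < s) (hsr : s < r) (hr : r ≤ T)
    (x : ℕ → Fin K → ℝ) (w : (Fin (t - 1) → ℕ) → ℝ) (α : ℝ) :
    (∑ y ∈ Fintype.piFinset (fun _ : Fin T => Finset.Icc 1 Q),
      w (fun i => fullPath T y0 y (i.val + 1)) *
      (let p := fullPath T y0 y
       let z := zidx β γ x p
       if p t ≤ q1 ∧ p s = 1 ∧ q3 < p r then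
          Real.exp (z s - z r + (lam q3 - lam 1)) - 1
        else if p t ≤ q1 ∧ 1 < p s then -1
        else if q1 < p t ∧ p s = 1 ∧ p r ≤ q3 then
          Real.exp (z r - z t + (lam q1 - lam q3))
        else if q1 < p t ∧ p s = 1 ∧ q3 < p r then
          Real.exp (z s - z t + (lam q1 - lam 1))
        else 0) *
      pathProb Q T β γ lam x α (fullPath T y0 y)) = 0 := by
  rw [Finset.mem_Icc] at hq1 hq3
  set g : ℕ → ℕ → ℝ := fun u v => (∑ k, x u k * β k) + γ v with hg
  set F : (ℕ → ℕ) → ℝ := fun p => if p t ≤ q1 ∧ p s = 1 ∧ q3 < p r then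
          Real.exp (g s (p (s - 1)) - g r (p (r - 1)) + (lam q3 - lam 1)) - 1
        else if p t ≤ q1 ∧ 1 < p s then -1
        else if q1 < p t ∧ p s = 1 ∧ p r ≤ q3 then
          Real.exp (g r (p (r - 1)) - g t (p (t - 1)) + (lam q1 - lam q3))
        else if q1 < p t ∧ p s = 1 ∧ q3 < p r then
          Real.exp (g s (p (s - 1)) - g t (p (t - 1)) + (lam q1 - lam 1))
        else 0 with hF
  have main := sum_eq_ES (fun u v q => catProb Q lam (g u v + α) q) Q T y0
    (fun p => w (fun i => p (i.val + 1)) * F p)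
  refine Eq.trans ?_ (main.trans ?_)
  · rfl
  obtain ⟨a, ha⟩ : ∃ a, s = t + 1 + a := ⟨s - t - 1, by omega⟩
  obtain ⟨b, hb⟩ : ∃ b, r = s + 1 + b := ⟨r - s - 1, by omega⟩
  obtain ⟨d, hd⟩ : ∃ d, T = r + d := ⟨T - r, by omega⟩
  have hTT : T = (t - 1) + (1 + (a + (1 + (b + (1 + d))))) := by omega
  have hc : ∀ u v, ∑ q ∈ Finset.Icc 1 Q, catProb Q lam (g u v + α) q = 1 :=
    fun u v => catProb_total Q hQ _ _
  rw [hTT, ES_add, show 1 + (t - 1) = t by omega]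
  rw [ES_congr _ Q (t - 1) 1 _ _ (fun _ => 0), ES_const _ Q hc]
  intro p _
  rw [ES_congr _ Q _ t p _ (fun p' => w (fun i => p (i.val + 1)) * F p' + 0), ES_affine _ Q hc,
    hF, core Q hQ g lam α q1 q3 hq1.1 (by omega) hq3.1 (by omega) t a b d s r ht ha hb p]
  · simp
  · intro p' hp'
    rw [add_zero]
    congr 2
    funext i
    exact hp' _ (by have := i.isLt; omega)
end

section
/- (Master lemma for binarized outcomes.) Let Q ≥ 2 be an integer, let π_1 ∈ ℝ, and let π_2, π_3 : {1,…,Q} → ℝ. Let p_1(ỹ_1) = Λ((2ỹ_1 − 1)π_1) for ỹ_1 ∈ {0,1}, p_2(ỹ_2|w) = Λ((2ỹ_2 − 1)π_2(w)) for ỹ_2 ∈ {0,1}, and p_3(ỹ_3|v) = Λ((2ỹ_3 − 1)π_3(v)) for ỹ_3 ∈ {0,1}. Let f(·|ỹ_1) : {1,…,Q} → [0,1] with Σ_w f(w|ỹ_1) = 1 for each ỹ_1 ∈ {0,1}, and let g(·|ỹ_2, w) : {1,…,Q} → [0,1] with Σ_v g(v|ỹ_2, w) = 1 for each ỹ_2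 ∈ {0,1} and w, and assume g(v|1, w) does not depend on w. Define m(ỹ_1, ỹ_2, ỹ_3, w, v) casewise by: exp(π_1 − π_2(w)) if (ỹ_1, ỹ_2, ỹ_3) = (0,1,0); exp(π_1 − π_3(v)) if (ỹ_1, ỹ_2, ỹ_3) = (0,1,1); −1 if (ỹ_1, ỹ_2) = (1,0); exp(π_3(v) − π_2(w)) − 1 if (ỹ_1, ỹ_2, ỹ_3) = (1,1,0); and 0 otherwise. Then Σ_{ỹ_1, ỹ_2, ỹ_3 ∈ {0,1}} Σ_{w=1}^{Q} Σ_{v=1}^{Q} m(ỹ_1, ỹ_2, ỹ_3, w, v) · p_3(ỹ_3|v) · g(v|ỹ_2, w) · p_2(ỹ_2|w) · f(w|ỹ_1) · p_1(ỹ_1) = 0. -/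
open Finset

theorem Lam_neg_eq (u : ℝ) : Lam (-u) = 1 - Lam u := by
  unfold Lam
  have h1 : (1 + Real.exp (-u)) ≠ 0 := by positivity
  have h2 : (1 + Real.exp u) ≠ 0 := by positivity
  have h3 : Real.exp u * Real.exp (-u) = 1 := by rw [← Real.exp_add]; simp
  rw [neg_neg]
  field_simp
  linarith

theorem exp_neg_mul_Lam (u : ℝ) : Real.exp (-u) * Lam u = 1 - Lam u := by
  unfold Lam
  have h1 : (1 + Real.exp (-u)) ≠ 0 := by positivity
  field_simp
  ring

theorem exp_mul_Lam (u : ℝ) : Real.exp u * (1 - Lam u) = Lam u := by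
  rw [← exp_neg_mul_Lam, ← mul_assoc, ← Real.exp_add]; simp

theorem statement7 (Q : ℕ) (hQ : 2 ≤ Q) (π1 : ℝ) (π2 π3 : ℕ → ℝ)
    (f : ℕ → ℕ → ℝ)
    (hf01 : ∀ y1 ∈ Finset.range 2, ∀ w ∈ Finset.Icc 1 Q, 0 ≤ f y1 w ∧ f y1 w ≤ 1)
    (hfsum : ∀ y1 ∈ Finset.range 2, ∑ w ∈ Finset.Icc 1 Q, f y1 w = 1)
    (g : ℕ → ℕ → ℕ → ℝ)
    (hg01 : ∀ y2 ∈ Finset.range 2, ∀ w ∈ Finset.Icc 1 Q, ∀ v ∈ Finset.Icc 1 Q,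
        0 ≤ g y2 w v ∧ g y2 w v ≤ 1)
    (hgsum : ∀ y2 ∈ Finset.range 2, ∀ w ∈ Finset.Icc 1 Q,
        ∑ v ∈ Finset.Icc 1 Q, g y2 w v = 1)
    (hgind : ∀ w ∈ Finset.Icc 1 Q, ∀ w' ∈ Finset.Icc 1 Q, ∀ v ∈ Finset.Icc 1 Q,
        g 1 w v = g 1 w' v) :
    (∑ y1 ∈ Finset.range 2, ∑ y2 ∈ Finset.range 2, ∑ y3 ∈ Finset.range 2,
      ∑ w ∈ Finset.Icc 1 Q, ∑ v ∈ Finset.Icc 1 Q,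
      (if y1 = 0 ∧ y2 = 1 ∧ y3 = 0 then Real.exp (π1 - π2 w)
        else if y1 = 0 ∧ y2 = 1 ∧ y3 = 1 then Real.exp (π1 - π3 v)
        else if y1 = 1 ∧ y2 = 0 then -1
        else if y1 = 1 ∧ y2 = 1 ∧ y3 = 0 then Real.exp (π3 v - π2 w) - 1
        else 0) *
      Lam ((2 * (y3 : ℝ) - 1) * π3 v) *
      g y2 w v *
      Lam ((2 * (y2 : ℝ) - 1) * π2 w) *
      f y1 w *
      Lam ((2 * (y1 : ℝ) - 1) * π1)) = 0 := by
  have hr0 : (0 : ℕ) ∈ Finset.range 2 := by simp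
  have hr1 : (1 : ℕ) ∈ Finset.range 2 := by simp
  have h1Q : 1 ∈ Finset.Icc 1 Q := by simp; omega
  have e : ∀ a b : ℝ, Real.exp (a - b) = Real.exp a * Real.exp (-b) := by
    intro a b; rw [← Real.exp_add, sub_eq_add_neg]
  have n1 : ((2 : ℝ) * 1 - 1) = 1 := by norm_num
  obtain ⟨S, hS⟩ : ∃ S, S = ∑ v ∈ Finset.Icc 1 Q, g 1 1 v * (1 - Lam (π3 v)) := ⟨_, rfl⟩
  -- contribution of `y1 = 0`, for each `w`
  have A : ∀ w ∈ Finset.Icc 1 Q,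
      (∑ v ∈ Finset.Icc 1 Q, Real.exp (π1 - π2 w) * (1 - Lam (π3 v)) * g 1 w v *
        Lam (π2 w) * f 0 w * (1 - Lam π1)) +
      (∑ v ∈ Finset.Icc 1 Q, Real.exp (π1 - π3 v) * Lam (π3 v) * g 1 w v *
        Lam (π2 w) * f 0 w * (1 - Lam π1)) = Lam π1 * S * f 0 w := by
    intro w hw
    rw [← Finset.sum_add_distrib, hS, Finset.mul_sum, Finset.sum_mul]
    refine Finset.sum_congr rfl fun v hv => ?_
    rw [hgind w hw 1 h1Q v hv, e, e]
    have a := exp_mul_Lam π1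
    have b := exp_neg_mul_Lam (π2 w)
    have c := exp_neg_mul_Lam (π3 v)
    calc _ = (Real.exp π1 * (1 - Lam π1)) * g 1 1 v * f 0 w *
          ((Real.exp (-π2 w) * Lam (π2 w)) * (1 - Lam (π3 v)) +
            (Real.exp (-π3 v) * Lam (π3 v)) * Lam (π2 w)) := by ring
      _ = _ := by rw [a, b, c]; ring
  -- contribution of `y1 = 1`, for each `w`
  have B : ∀ w ∈ Finset.Icc 1 Q,
      (∑ v ∈ Finset.Icc 1 Q, (-1) * (1 - Lam (π3 v)) * g 0 w v *
        (1 - Lam (π2 w)) * f 1 w * Lam π1) +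
      (∑ v ∈ Finset.Icc 1 Q, (-1) * Lam (π3 v) * g 0 w v *
        (1 - Lam (π2 w)) * f 1 w * Lam π1) +
      (∑ v ∈ Finset.Icc 1 Q, (Real.exp (π3 v - π2 w) - 1) * (1 - Lam (π3 v)) * g 1 w v *
        Lam (π2 w) * f 1 w * Lam π1) = -(Lam π1 * S) * f 1 w := by
    intro w hw
    have B1 : (∑ v ∈ Finset.Icc 1 Q, (-1) * (1 - Lam (π3 v)) * g 0 w v *
        (1 - Lam (π2 w)) * f 1 w * Lam π1) +
      (∑ v ∈ Finset.Icc 1 Q, (-1) * Lam (π3 v) * g 0 w v *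
        (1 - Lam (π2 w)) * f 1 w * Lam π1) =
        ∑ v ∈ Finset.Icc 1 Q, g 1 w v * (-((1 - Lam (π2 w)) * f 1 w * Lam π1)) := by
      rw [← Finset.sum_mul (f := fun v => g 1 w v), (hgsum 1 hr1 w hw).trans (hgsum 0 hr0 w hw).symm,
        Finset.sum_mul, ← Finset.sum_add_distrib]
      exact Finset.sum_congr rfl fun v _ => by ring
    rw [B1, ← Finset.sum_add_distrib, hS, Finset.mul_sum, ← Finset.sum_neg_distrib,
      Finset.sum_mul]
    refine Finset.sum_congr rfl fun v hv => ?_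
    rw [hgind w hw 1 h1Q v hv, e]
    have b := exp_neg_mul_Lam (π2 w)
    have c := exp_mul_Lam (π3 v)
    calc _ = g 1 1 v * f 1 w * Lam π1 * (-(1 - Lam (π2 w)) +
          (Real.exp (π3 v) * (1 - Lam (π3 v))) * (Real.exp (-π2 w) * Lam (π2 w))
          - (1 - Lam (π3 v)) * Lam (π2 w)) := by ring
      _ = _ := by rw [b, c]; ring
  have A' := Finset.sum_congr rfl A
  have B' := Finset.sum_congr rfl B
  rw [← Finset.mul_sum, hfsum 0 hr0, Finset.sum_add_distrib] at A'
  rw [← Finset.mul_sum, hfsum 1 hr1, Finset.sum_add_distrib, Finset.sum_add_distrib] at B'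
  simp only [Finset.sum_range_succ, Finset.sum_range_zero, Nat.cast_zero, Nat.cast_one, n1,
    mul_zero, zero_sub, neg_one_mul (π1), one_mul, zero_ne_one, one_ne_zero, and_true, true_and,
    and_false, false_and, if_true, if_false, zero_mul, Finset.sum_const_zero, zero_add, add_zero]
  simp only [show ∀ x : ℝ, Lam (-1 * x) = 1 - Lam x from fun x => by
    rw [neg_one_mul, Lam_neg_eq]]
  simp only [Lam_neg_eq]
  linarith
end

section
/- Let Q ≥ 2 be an integer and let B be a real Q × Q matrix all of whose off-diagonal entries are positive (B_{q,r} > 0 whenever q ≠ r). Let g⁰, g ∈ ℝ^Q be two vectors all of whose entries are positive. If B g⁰ = 0 and B g = 0, then there exists κ > 0 such that g = κ · g⁰. -/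
theorem statement8 (Q : ℕ) (hQ : 2 ≤ Q)
    (B : Matrix (Fin Q) (Fin Q) ℝ)
    (hB : ∀ q r : Fin Q, q ≠ r → 0 < B q r)
    (g0 g : Fin Q → ℝ)
    (hg0 : ∀ q, 0 < g0 q) (hg : ∀ q, 0 < g q)
    (h0 : B.mulVec g0 = 0) (h1 : B.mulVec g = 0) :
    ∃ κ : ℝ, 0 < κ ∧ g = κ • g0 := by
  haveI : Nonempty (Fin Q) := ⟨⟨0, by omega⟩⟩
  obtain ⟨q, hq⟩ := Finite.exists_min (fun r => g r / g0 r)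
  obtain ⟨k, hk⟩ : ∃ k, k = g q / g0 q := ⟨_, rfl⟩
  have hqz : g q - k * g0 q = 0 := by
    rw [hk, div_mul_cancel₀ _ (hg0 q).ne', sub_self]
  have hnn : ∀ r, 0 ≤ g r - k * g0 r := by
    intro r
    have h := hq r
    simp only [← hk] at h
    rw [le_div_iff₀ (hg0 r)] at h
    linarith
  have hsum : ∑ r, B q r * (g r - k * g0 r) = 0 := by
    have e0 : ∑ r, B q r * g0 r = 0 := congrFun h0 q
    have e1 : ∑ r, B q r * g r = 0 := congrFun h1 q
    calc ∑ r, B q r * (g r - k * g0 r)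
        = ∑ r, B q r * g r - k * ∑ r, B q r * g0 r := by
          rw [Finset.mul_sum, ← Finset.sum_sub_distrib]
          exact Finset.sum_congr rfl fun r _ => by ring
      _ = 0 := by rw [e0, e1]; ring
  have hterm : ∀ r ∈ Finset.univ, 0 ≤ B q r * (g r - k * g0 r) := by
    intro r _
    by_cases h : q = r
    · subst h; rw [hqz, mul_zero]
    · exact mul_nonneg (hB q r h).le (hnn r)
  have hall := (Finset.sum_eq_zero_iff_of_nonneg hterm).1 hsum
  refine ⟨k, hk ▸ div_pos (hg q) (hg0 q), ?_⟩
  ext r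
  simp only [Pi.smul_apply, smul_eq_mul]
  by_cases h : q = r
  · subst h; linarith
  · rcases mul_eq_zero.1 (hall r (Finset.mem_univ r)) with h' | h'
    · exact absurd h' (hB q r h).ne'
    · linarith
end

section
/- Let K ≥ 1 be an integer. For every sign vector s = (s_1,…,s_{K−1}, +) ∈ {−,+}^K with last component +, let g_s : ℝ^K → ℝ be a continuous function such that for all β ∈ ℝ^K: (i) g_s(β) is strictly increasing in β_K; (ii) for every m ∈ {1,…,K−1} with s_m = +, g_s(β) is strictly increasing in β_m; (iii) for every m ∈ {1,…,K−1} with s_m = −, g_s(β) is strictly decreasing in β_m. Then the system of 2^{K−1} equations g_s(β) = 0, for all s ∈ {−,+}^K with s_K = +, has at most one solution β ∈ ℝ^K; that is, if β and β′ both satisfy all these equations then β = β′. -/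
theorem chain_lt {ι : Type*} [Fintype ι] [DecidableEq ι] (f : (ι → ℝ) → ℝ) (β β' : ι → ℝ)
    (h : ∀ m, β m ≠ β' m → ∀ γ : ι → ℝ,
      f (Function.update γ m (β m)) < f (Function.update γ m (β' m)))
    (hne : β ≠ β') : f β < f β' := by
  have key : ∀ S : Finset ι, f β ≤ f (S.piecewise β' β) ∧
      ((∃ m ∈ S, β m ≠ β' m) → f β < f (S.piecewise β' β)) := by
    intro S
    induction S using Finset.induction_on with
    | empty => simp
    | insert a S ha ih =>
      have e : Function.update (S.piecewise β' β) a (β a) = S.piecewise β' β := by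
        rw [Function.update_eq_self_iff]
        simp [ha]
      rw [Finset.piecewise_insert]
      by_cases hab : β a = β' a
      · rw [← hab, e]
        refine ⟨ih.1, ?_⟩
        rintro ⟨m, hm, hm'⟩
        rcases Finset.mem_insert.1 hm with rfl | hm
        · exact absurd hab hm'
        · exact ih.2 ⟨m, hm, hm'⟩
      · have := h a hab (S.piecewise β' β)
        rw [e] at this
        have h2 := lt_of_le_of_lt ih.1 this
        exact ⟨h2.le, fun _ => h2⟩
  obtain ⟨m, hm⟩ := Function.ne_iff.1 hne
  have := (key Finset.univ).2 ⟨m, Finset.mem_univ m, hm⟩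
  simpa using this

theorem statement9 (K : ℕ) (hK : 1 ≤ K)
    (g : (Fin K → Bool) → (Fin K → ℝ) → ℝ)
    (hcont : ∀ s : Fin K → Bool, s ⟨K - 1, by omega⟩ = true → Continuous (g s))
    (hlast : ∀ s : Fin K → Bool, s ⟨K - 1, by omega⟩ = true →
        ∀ (β : Fin K → ℝ) (c c' : ℝ), c < c' →
        g s (Function.update β ⟨K - 1, by omega⟩ c) <
          g s (Function.update β ⟨K - 1, by omega⟩ c'))
    (hinc : ∀ s : Fin K → Bool, s ⟨K - 1, by omega⟩ = true →
        ∀ m : Fin K, (m : ℕ) < K - 1 → s m = true →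
        ∀ (β : Fin K → ℝ) (c c' : ℝ), c < c' →
        g s (Function.update β m c) < g s (Function.update β m c'))
    (hdec : ∀ s : Fin K → Bool, s ⟨K - 1, by omega⟩ = true →
        ∀ m : Fin K, (m : ℕ) < K - 1 → s m = false →
        ∀ (β : Fin K → ℝ) (c c' : ℝ), c < c' →
        g s (Function.update β m c') < g s (Function.update β m c))
    (β β' : Fin K → ℝ)
    (hβ : ∀ s : Fin K → Bool, s ⟨K - 1, by omega⟩ = true → g s β = 0)
    (hβ' : ∀ s : Fin K → Bool, s ⟨K - 1, by omega⟩ = true → g s β' = 0) :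
    β = β' := by
  have main : ∀ β β' : Fin K → ℝ,
      (∀ s : Fin K → Bool, s ⟨K - 1, by omega⟩ = true → g s β = 0) →
      (∀ s : Fin K → Bool, s ⟨K - 1, by omega⟩ = true → g s β' = 0) →
      β ⟨K - 1, by omega⟩ ≤ β' ⟨K - 1, by omega⟩ → β = β' := by
    intro β β' hβ hβ' hle
    by_contra hne
    have hs : (fun m => decide (β m ≤ β' m)) (⟨K - 1, by omega⟩ : Fin K) = true := by
      simpa using hle
    have hlt := chain_lt (g (fun m => decide (β m ≤ β' m))) β β' (by
      intro m hm γ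
      by_cases hmK : (m : ℕ) < K - 1
      · rcases lt_or_gt_of_ne hm with h | h
        · exact hinc _ hs m hmK (by simpa using h.le) γ _ _ h
        · exact hdec _ hs m hmK (by simpa using h) γ _ _ h
      · have hm' : m = ⟨K - 1, Nat.sub_lt hK Nat.one_pos⟩ := by
          apply Fin.ext
          have := m.isLt
          simp only
          omega
        subst hm'
        exact hlast _ hs γ _ _ (lt_of_le_of_ne hle hm)) hne
    rw [hβ _ hs, hβ' _ hs] at hlt
    exact lt_irrefl _ hlt
  rcases le_total (β ⟨K - 1, by omega⟩) (β' ⟨K - 1, by omega⟩) with h | h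
  · exact main β β' hβ hβ' h
  · exact (main β' β hβ' hβ h).symm
end

section
/- (Identification of γ.) Fix Q ≥ 2, K ≥ 1, T = 3, a true parameter θ⁰ = (β⁰, γ⁰, λ⁰) with λ⁰_1 < … < λ⁰_{Q−1}, and a regressor value x_1 ∈ ℝ^K. Suppose for each y_0 ∈ {1,…,Q} there are a finite Borel measure μ_{y_0} on ℝ with μ_{y_0}(ℝ) > 0 and nonnegative weights w_+(y_0), w_−(y_0) with μ_{y_0}(ℝ) + w_+(y_0) + w_−(y_0) = 1, and define the distribution P_{y_0} on paths y ∈ {1,…,Q}^3 by P_{y_0}(y) = ∫_ℝ p_{y_0}(y, (x_1, x_1, x_1), θ⁰, α) μ_{y_0}(dα) + w_+(y_0)·1{y = (Q,Q,Q)} + w_−(y_0)·1{y = (1,1,1)}. For γ ∈ ℝ^Q define the moment function m_{y_0}(y, γ) casewise by: −exp(γ_{y_0}) if y_1 = 1 and y_2 > 1; exp(γ_1) if y_1 > 1, y_2 = 1, y_3 = 1; exp(γ_{y_1}) if y_1 > 1, y_2 = 1, y_3 > 1; and 0 otherwise. If γ ∈ ℝ^Q satisfies Σ_{y ∈ {1,…,Q}^3}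 m_{y_0}(y, γ) · P_{y_0}(y) = 0 for all y_0 ∈ {1,…,Q}, then there exists c ∈ ℝ such that γ_q = γ⁰_q + c for all q ∈ {1,…,Q}. In particular, under the normalization γ_1 = γ⁰_1 = 0 one has γ = γ⁰. -/
open Finset MeasureTheory

theorem Lam_pos (u : ℝ) : 0 < Lam u := by unfold Lam; positivity

theorem Lam_lt_one (u : ℝ) : Lam u < 1 := by
  unfold Lam
  have := Real.exp_pos (-u)
  rw [div_lt_one (by linarith)]
  linarith

theorem Lam_strictMono {u v : ℝ} (h : u < v) : Lam u < Lam v := by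
  unfold Lam
  have := Real.exp_pos (-v)
  have h2 : Real.exp (-v) < Real.exp (-u) := Real.exp_lt_exp.2 (by linarith)
  exact one_div_lt_one_div_of_lt (by linarith) (by linarith)

theorem catProb_pos {Q : ℕ} (hQ : 2 ≤ Q) {lam : ℕ → ℝ}
    (hlam : ∀ q r : ℕ, 1 ≤ q → q < r → r ≤ Q - 1 → lam q < lam r) (ζ : ℝ) {q : ℕ}
    (h1 : 1 ≤ q) (h2 : q ≤ Q) : 0 < catProb Q lam ζ q := by
  unfold catProb
  split_ifs with ha hb hb
  · omega
  · linarith [Lam_lt_one (ζ - lam q)]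
  · linarith [Lam_pos (ζ - lam (q - 1))]
  · have h := hlam (q - 1) q (by omega) (by omega) (by omega)
    have := Lam_strictMono (u := ζ - lam q) (v := ζ - lam (q - 1)) (by linarith)
    linarith

theorem catProb_sum {Q : ℕ} (hQ : 2 ≤ Q) (lam : ℕ → ℝ) (ζ : ℝ) :
    ∑ q ∈ Finset.Icc 1 Q, catProb Q lam ζ q = 1 := by
  let f : ℕ → ℝ := fun k => if k = 0 then 1 else if k = Q then 0 else Lam (ζ - lam k)
  have h1 : ∑ q ∈ Finset.Icc 1 Q, catProb Q lam ζ q = ∑ k ∈ Finset.range Q, (f k - f (k + 1)) := by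
    rw [← Finset.Ico_add_one_right_eq_Icc, Finset.sum_Ico_eq_sum_range]
    apply Finset.sum_congr (by simp)
    intro k hk
    have hk' : k < Q := by simpa using hk
    have e : 1 + k - 1 = k := by omega
    simp only [catProb, f, e, add_comm k 1]
    have n1 : k ≠ Q := by omega
    by_cases hk0 : k = 0 <;> simp [hk0, n1]
  rw [h1, Finset.sum_range_sub']
  have : Q ≠ 0 := by omega
  simp [f, this]

theorem catProb_one {Q : ℕ} (hQ : 2 ≤ Q) (lam : ℕ → ℝ) (ζ : ℝ) :
    catProb Q lam ζ 1 = 1 / (1 + Real.exp (ζ - lam 1)) := by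
  have : 1 ≠ Q := by omega
  have h := Real.exp_pos (ζ - lam 1)
  simp only [catProb, Lam, this, if_true, if_false, Real.exp_neg]
  field_simp
  ring

theorem Icc_split {Q : ℕ} (hQ : 2 ≤ Q) (f : ℕ → ℝ) :
    ∑ q ∈ Finset.Icc 1 Q, f q = f 1 + ∑ q ∈ Finset.Icc 2 Q, f q := by
  rw [← Finset.insert_Icc_add_one_left_eq_Icc (show 1 ≤ Q by omega), Finset.sum_insert (by simp)]
  rfl

/-- the moment function -/
noncomputable def mom (γ : ℕ → ℝ) (y0 y1 y2 y3 : ℕ) : ℝ :=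
  if y1 = 1 ∧ 1 < y2 then -Real.exp (γ y0)
          else if 1 < y1 ∧ y2 = 1 ∧ y3 = 1 then Real.exp (γ 1)
          else if 1 < y1 ∧ y2 = 1 ∧ 1 < y3 then Real.exp (γ y1)
          else 0

theorem mom_sum {Q : ℕ} (hQ : 2 ≤ Q) (γ : ℕ → ℝ) (y0 : ℕ) (p : ℕ → ℕ → ℝ)
    (hp : ∀ l, ∑ q ∈ Finset.Icc 1 Q, p l q = 1) :
    ∑ y1 ∈ Finset.Icc 1 Q, ∑ y2 ∈ Finset.Icc 1 Q, ∑ y3 ∈ Finset.Icc 1 Q,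
      mom γ y0 y1 y2 y3 * (p y0 y1 * p y1 y2 * p y2 y3) =
    -Real.exp (γ y0) * p y0 1 * (1 - p 1 1) + ∑ q ∈ Finset.Icc 2 Q,
      p y0 q * (p q 1 * (Real.exp (γ 1) * p 1 1 + Real.exp (γ q) * (1 - p 1 1))) := by
  have hp2 : ∀ l, ∑ q ∈ Finset.Icc 2 Q, p l q = 1 - p l 1 := by
    intro l
    have := hp l
    rw [Icc_split hQ] at this
    linarith
  rw [Icc_split hQ]
  congr 1
  · rw [Icc_split hQ]
    have z : ∑ y3 ∈ Finset.Icc 1 Q, mom γ y0 1 1 y3 * (p y0 1 * p 1 1 * p 1 y3) = 0 := by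
      apply Finset.sum_eq_zero
      intro y3 _
      simp [mom]
    rw [z, zero_add, ← hp2, Finset.mul_sum]
    apply Finset.sum_congr rfl
    intro y2 h2
    have h2' : 1 < y2 := by have := (Finset.mem_Icc.1 h2).1; omega
    simp only [mom, h2', and_self, if_true]
    rw [← Finset.mul_sum, ← Finset.mul_sum, hp]
    ring
  · apply Finset.sum_congr rfl
    intro q hq
    have hq' : 1 < q := by have := (Finset.mem_Icc.1 hq).1; omega
    have hq1 : q ≠ 1 := by omega
    rw [Icc_split hQ]
    have z : ∑ y2 ∈ Finset.Icc 2 Q, ∑ y3 ∈ Finset.Icc 1 Q,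
        mom γ y0 q y2 y3 * (p y0 q * p q y2 * p y2 y3) = 0 := by
      apply Finset.sum_eq_zero
      intro y2 h2
      have h2' : y2 ≠ 1 := by have := (Finset.mem_Icc.1 h2).1; omega
      apply Finset.sum_eq_zero
      intro y3 _
      simp [mom, hq1, h2']
    rw [z, add_zero, Icc_split hQ]
    have e : ∑ y3 ∈ Finset.Icc 2 Q, mom γ y0 q 1 y3 * (p y0 q * p q 1 * p 1 y3)
        = Real.exp (γ q) * (p y0 q * p q 1) * (1 - p 1 1) := by
      rw [← hp2, Finset.mul_sum]
      apply Finset.sum_congr rfl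
      intro y3 h3
      have h3' : 1 < y3 := by have := (Finset.mem_Icc.1 h3).1; omega
      have h31 : y3 ≠ 1 := by omega
      simp only [mom, hq1, hq', h3', h31, false_and, and_false, if_false, and_self, if_true]
      ring
    rw [e]
    simp only [mom, hq1, hq', false_and, if_false, and_self, if_true]
    ring

/-- pointwise form of the moment -/
theorem mom_pointwise {Q : ℕ} (hQ : 2 ≤ Q) (lam γ γ0 : ℕ → ℝ) (b α : ℝ) (y0 : ℕ) :
    ∑ y1 ∈ Finset.Icc 1 Q, ∑ y2 ∈ Finset.Icc 1 Q, ∑ y3 ∈ Finset.Icc 1 Q,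
      mom γ y0 y1 y2 y3 * (catProb Q lam (b + γ0 y0 + α) y1 * catProb Q lam (b + γ0 y1 + α) y2
        * catProb Q lam (b + γ0 y2 + α) y3) =
    Real.exp (γ0 1) / (1 + Real.exp (b + γ0 1 + α - lam 1)) * ∑ q ∈ Finset.Icc 2 Q,
      catProb Q lam (b + γ0 y0 + α) q *
        (Real.exp (γ 1 - γ0 1) * (1 - Lam (b + γ0 q + α - lam 1))
          + Real.exp (γ q - γ0 q) * Lam (b + γ0 q + α - lam 1) - Real.exp (γ y0 - γ0 y0)) := by
  have hs := fun l => catProb_sum hQ lam (b + γ0 l + α)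
  rw [mom_sum hQ γ y0 (fun l q => catProb Q lam (b + γ0 l + α) q) hs]
  have h0 := hs y0
  rw [Icc_split hQ] at h0
  simp only [mul_sub, Finset.sum_sub_distrib, ← Finset.sum_mul]
  rw [eq_sub_of_add_eq' h0]
  have key : ∀ q, b + γ0 q + α - lam 1 = γ0 q + (b + α - lam 1) := fun q => by ring
  simp only [catProb_one hQ, Lam, Real.exp_neg, key, Real.exp_add, Real.exp_sub]
  have ha : 0 < Real.exp (b) * Real.exp α / Real.exp (lam 1) := by positivity
  generalize Real.exp (b) * Real.exp α / Real.exp (lam 1) = a at *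
  have g0 := fun q => Real.exp_pos (γ0 q)
  have g := fun q => Real.exp_pos (γ q)
  rw [sub_eq_neg_add (Real.exp (γ0 1) / (1 + Real.exp (γ0 1) * a) * _)]
  congr 1
  · have := g0 1
    have := g0 y0
    field_simp
    ring
  · rw [Finset.mul_sum]
    apply Finset.sum_congr rfl
    intro q _
    have := g0 1
    have := g0 q
    field_simp
    ring

theorem measurable_catProb (Q : ℕ) (lam : ℕ → ℝ) (c : ℝ) (q : ℕ) :
    Measurable fun α : ℝ => catProb Q lam (c + α) q := by
  unfold catProb Lam
  split_ifs <;> fun_prop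

theorem catProb_le_one {Q : ℕ} (lam : ℕ → ℝ) (ζ : ℝ) (q : ℕ) :
    catProb Q lam ζ q ≤ 1 := by
  unfold catProb
  have := Lam_lt_one (ζ - lam (q-1))
  have := Lam_pos (ζ - lam q)
  split_ifs <;> linarith

theorem integrable_prod {Q : ℕ} (hQ : 2 ≤ Q) {lam : ℕ → ℝ}
    (hlam : ∀ q r : ℕ, 1 ≤ q → q < r → r ≤ Q - 1 → lam q < lam r)
    (μ : Measure ℝ) [IsFiniteMeasure μ] (c1 c2 c3 : ℝ) {y1 y2 y3 : ℕ}
    (h1 : y1 ∈ Finset.Icc 1 Q) (h2 : y2 ∈ Finset.Icc 1 Q) (h3 : y3 ∈ Finset.Icc 1 Q) :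
    Integrable (fun α => catProb Q lam (c1 + α) y1 * catProb Q lam (c2 + α) y2 *
      catProb Q lam (c3 + α) y3) μ := by
  rw [Finset.mem_Icc] at h1 h2 h3
  refine Integrable.of_bound (C := 1) ?_ ?_
  · exact (((measurable_catProb Q lam c1 y1).mul (measurable_catProb Q lam c2 y2)).mul
      (measurable_catProb Q lam c3 y3)).aestronglyMeasurable
  · refine Filter.Eventually.of_forall fun α => ?_
    have p1 := catProb_pos hQ hlam (c1 + α) h1.1 h1.2
    have p2 := catProb_pos hQ hlam (c2 + α) h2.1 h2.2
    have p3 := catProb_pos hQ hlam (c3 + α) h3.1 h3.2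
    rw [Real.norm_of_nonneg (by positivity)]
    exact mul_le_one₀ (mul_le_one₀ (catProb_le_one _ _ _) p2.le (catProb_le_one _ _ _)) p3.le
      (catProb_le_one _ _ _)

/-- The integrated moment cannot vanish if all brackets have the same strict sign `s`. -/
theorem no_sign {Q : ℕ} (hQ : 2 ≤ Q) {lam : ℕ → ℝ}
    (hlam : ∀ q r : ℕ, 1 ≤ q → q < r → r ≤ Q - 1 → lam q < lam r) (γ γ0 : ℕ → ℝ) (b : ℝ)
    (μ : Measure ℝ) [IsFiniteMeasure μ] (hμ : 0 < μ Set.univ) (wp wm : ℝ) {y0 : ℕ}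
    (hmom : (∑ y1 ∈ Finset.Icc 1 Q, ∑ y2 ∈ Finset.Icc 1 Q, ∑ y3 ∈ Finset.Icc 1 Q,
        mom γ y0 y1 y2 y3 *
        ((∫ α, catProb Q lam (b + γ0 y0 + α) y1 *
              catProb Q lam (b + γ0 y1 + α) y2 *
              catProb Q lam (b + γ0 y2 + α) y3 ∂μ) +
          wp * (if y1 = Q ∧ y2 = Q ∧ y3 = Q then 1 else 0) +
          wm * (if y1 = 1 ∧ y2 = 1 ∧ y3 = 1 then 1 else 0))) = 0)
    (s : ℝ) (hs : ∀ q ∈ Finset.Icc 2 Q, ∀ w : ℝ, 0 < w → w < 1 →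
      0 < s * (Real.exp (γ 1 - γ0 1) * (1 - w) + Real.exp (γ q - γ0 q) * w
        - Real.exp (γ y0 - γ0 y0))) : False := by
  let F : ℝ → ℝ := fun α => ∑ y1 ∈ Finset.Icc 1 Q, ∑ y2 ∈ Finset.Icc 1 Q, ∑ y3 ∈ Finset.Icc 1 Q,
      mom γ y0 y1 y2 y3 * (catProb Q lam (b + γ0 y0 + α) y1 * catProb Q lam (b + γ0 y1 + α) y2
        * catProb Q lam (b + γ0 y2 + α) y3)
  have hint : ∀ y1 ∈ Finset.Icc 1 Q, ∀ y2 ∈ Finset.Icc 1 Q, ∀ y3 ∈ Finset.Icc 1 Q,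
      Integrable (fun α => mom γ y0 y1 y2 y3 * (catProb Q lam (b + γ0 y0 + α) y1
        * catProb Q lam (b + γ0 y1 + α) y2 * catProb Q lam (b + γ0 y2 + α) y3)) μ :=
    fun y1 h1 y2 h2 y3 h3 => (integrable_prod hQ hlam μ _ _ _ h1 h2 h3).const_mul _
  have hF : Integrable F μ :=
    integrable_finsetSum _ fun y1 h1 => integrable_finsetSum _ fun y2 h2 =>
      integrable_finsetSum _ fun y3 h3 => hint y1 h1 y2 h2 y3 h3
  have hF0 : ∫ α, F α ∂μ = 0 := by
    rw [← hmom]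
    rw [integral_finsetSum _ fun y1 h1 => integrable_finsetSum _ fun y2 h2 =>
      integrable_finsetSum _ fun y3 h3 => hint y1 h1 y2 h2 y3 h3]
    refine Finset.sum_congr rfl fun y1 h1 => ?_
    rw [integral_finsetSum _ fun y2 h2 =>
      integrable_finsetSum _ fun y3 h3 => hint y1 h1 y2 h2 y3 h3]
    refine Finset.sum_congr rfl fun y2 h2 => ?_
    rw [integral_finsetSum _ fun y3 h3 => hint y1 h1 y2 h2 y3 h3]
    refine Finset.sum_congr rfl fun y3 h3 => ?_
    rw [integral_const_mul, add_assoc, mul_add]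
    have z : mom γ y0 y1 y2 y3 * (wp * (if y1 = Q ∧ y2 = Q ∧ y3 = Q then 1 else 0) +
          wm * (if y1 = 1 ∧ y2 = 1 ∧ y3 = 1 then 1 else 0)) = 0 := by
      have hQ1 : Q ≠ 1 := by omega
      by_cases ha : y1 = Q ∧ y2 = Q ∧ y3 = Q
      · obtain ⟨rfl, rfl, rfl⟩ := ha
        simp [mom, hQ1]
      · by_cases hb : y1 = 1 ∧ y2 = 1 ∧ y3 = 1
        · obtain ⟨rfl, rfl, rfl⟩ := hb
          simp [mom]
        · simp [ha, hb]
    rw [z, add_zero]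
  have hpos : ∀ α, 0 < s * F α := by
    intro α
    simp only [F]
    rw [mom_pointwise hQ, mul_left_comm, Finset.mul_sum]
    apply mul_pos (by positivity)
    apply Finset.sum_pos
    · intro q hq
      have hq' := Finset.mem_Icc.1 hq
      rw [mul_left_comm]
      exact mul_pos (catProb_pos hQ hlam _ (by omega) hq'.2) (hs q hq _ (Lam_pos _) (Lam_lt_one _))
    · exact ⟨2, by simp [hQ]⟩
  have hp : 0 < ∫ α, s * F α ∂μ := by
    rw [integral_pos_iff_support_of_nonneg (fun α => (hpos α).le) (hF.const_mul s)]
    have : Function.support (fun α => s * F α) = Set.univ := by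
      ext α
      simpa using (hpos α).ne'
    rw [this]
    exact hμ
  rw [integral_const_mul, hF0, mul_zero] at hp
  exact lt_irrefl _ hp

theorem statement10 (Q K : ℕ) (hQ : 2 ≤ Q) (hK : 1 ≤ K)
    (β0 : Fin K → ℝ) (γ0 lam0 : ℕ → ℝ)
    (hlam0 : ∀ q r : ℕ, 1 ≤ q → q < r → r ≤ Q - 1 → lam0 q < lam0 r)
    (x1 : Fin K → ℝ)
    (μ : ℕ → Measure ℝ) (hμfin : ∀ y0, IsFiniteMeasure (μ y0))
    (hμpos : ∀ y0 ∈ Finset.Icc 1 Q, 0 < μ y0 Set.univ)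
    (wp wm : ℕ → ℝ) (hwp : ∀ y0 ∈ Finset.Icc 1 Q, 0 ≤ wp y0)
    (hwm : ∀ y0 ∈ Finset.Icc 1 Q, 0 ≤ wm y0)
    (hsum1 : ∀ y0 ∈ Finset.Icc 1 Q, (μ y0 Set.univ).toReal + wp y0 + wm y0 = 1)
    (γ : ℕ → ℝ)
    (hmom : ∀ y0 ∈ Finset.Icc 1 Q,
      (∑ y1 ∈ Finset.Icc 1 Q, ∑ y2 ∈ Finset.Icc 1 Q, ∑ y3 ∈ Finset.Icc 1 Q,
        (if y1 = 1 ∧ 1 < y2 then -Real.exp (γ y0)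
          else if 1 < y1 ∧ y2 = 1 ∧ y3 = 1 then Real.exp (γ 1)
          else if 1 < y1 ∧ y2 = 1 ∧ 1 < y3 then Real.exp (γ y1)
          else 0) *
        ((∫ α, catProb Q lam0 ((∑ k, x1 k * β0 k) + γ0 y0 + α) y1 *
              catProb Q lam0 ((∑ k, x1 k * β0 k) + γ0 y1 + α) y2 *
              catProb Q lam0 ((∑ k, x1 k * β0 k) + γ0 y2 + α) y3 ∂(μ y0)) +
          wp y0 * (if y1 = Q ∧ y2 = Q ∧ y3 = Q then 1 else 0) +
          wm y0 * (if y1 = 1 ∧ y2 = 1 ∧ y3 = 1 then 1 else 0))) = 0) :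
    (∃ c : ℝ, ∀ q ∈ Finset.Icc 1 Q, γ q = γ0 q + c) ∧
      (γ 1 = 0 → γ0 1 = 0 → ∀ q ∈ Finset.Icc 1 Q, γ q = γ0 q) := by
  have hne : (Finset.Icc 1 Q).Nonempty := ⟨1, by simp; omega⟩
  have h1m : 1 ∈ Finset.Icc 1 Q := by simp; omega
  have hle : ∀ q ∈ Finset.Icc 1 Q, Real.exp (γ q - γ0 q) ≤ Real.exp (γ 1 - γ0 1) := by
    obtain ⟨y0, hy0, hmax⟩ := Finset.exists_max_image _ (fun q => Real.exp (γ q - γ0 q)) hne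
    by_contra hcon
    push Not at hcon
    obtain ⟨q', hq', hlt⟩ := hcon
    have hlt2 := hlt.trans_le (hmax q' hq')
    have := hμfin y0
    refine no_sign hQ hlam0 γ γ0 _ (μ y0) (hμpos y0 hy0) _ _ (hmom y0 hy0) (-1) ?_
    intro q hq w hw0 hw1
    have hq2 := Finset.mem_Icc.1 hq
    have := hmax q (Finset.mem_Icc.2 ⟨by omega, hq2.2⟩)
    nlinarith
  have hge : ∀ q ∈ Finset.Icc 1 Q, Real.exp (γ 1 - γ0 1) ≤ Real.exp (γ q - γ0 q) := by
    obtain ⟨y0, hy0, hmin⟩ := Finset.exists_min_image _ (fun q => Real.exp (γ q - γ0 q)) hne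
    by_contra hcon
    push Not at hcon
    obtain ⟨q', hq', hlt⟩ := hcon
    have hlt2 := (hmin q' hq').trans_lt hlt
    have := hμfin y0
    refine no_sign hQ hlam0 γ γ0 _ (μ y0) (hμpos y0 hy0) _ _ (hmom y0 hy0) 1 ?_
    intro q hq w hw0 hw1
    have hq2 := Finset.mem_Icc.1 hq
    have := hmin q (Finset.mem_Icc.2 ⟨by omega, hq2.2⟩)
    nlinarith
  have heq : ∀ q ∈ Finset.Icc 1 Q, γ q = γ0 q + (γ 1 - γ0 1) := by
    intro q hq
    have := Real.exp_injective (le_antisymm (hle q hq) (hge q hq))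
    linarith
  refine ⟨⟨_, heq⟩, fun ha hb q hq => ?_⟩
  rw [heq q hq, ha, hb]
  ring
end
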